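/- arXiv:2009.08226 — 2 statements merged into one kernel-verified Lean document; each statement's English description precedes it below -/
import Mathlib

section
/- For every real number C > 0 there exists N such that every finite nilpotent group G with |G| ≥ N satisfies k(G) > C · |cd(G)|. (Equivalently, k(G)/|cd(G)| → ∞ as |G| → ∞ over finite nilpotent groups G.) -/
open CategoryTheory

/-- The set of degrees of the complex irreducible characters of `G`: the
dimensions of the simple finite-dimensional complex representations of `G`. -/
noncomputable def charDegrees (G : Type) [Group G] : Set ℕ :=
  {n | ∃ V : FDRep ℂ G, Simple V ∧ Module.finrank ℂ V = n}

/-- The elements of `S` that commute with `g`. -/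
def commSet {G : Type*} [Group G] (S : Set G) (g : G) : Set G := {x | x ∈ S ∧ Commute g x}

/-- The number of pairs `(g, x)` of commuting elements with `x ∈ S`. -/
noncomputable def commCount {G : Type*} [Group G] [Fintype G] (S : Set G) : ℕ :=
  ∑ g : G, (commSet S g).ncard

section Counting

theorem card_conjClasses_quotient_le {G : Type*} [Group G] [Finite G]
    (N : Subgroup G) [N.Normal] :
    Nat.card (ConjClasses (G ⧸ N)) ≤ Nat.card (ConjClasses G) := by
  refine Nat.card_le_card_of_surjective (ConjClasses.map (QuotientGroup.mk' N)) ?_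
  intro y
  obtain ⟨y, rfl⟩ := ConjClasses.mk_surjective y
  obtain ⟨x, rfl⟩ := QuotientGroup.mk'_surjective N y
  exact ⟨ConjClasses.mk x, rfl⟩

variable {G : Type*} [Group G] [Fintype G]

theorem commCount_eq_ncard (S : Set G) :
    commCount S = {p : G × G | p.2 ∈ S ∧ Commute p.1 p.2}.ncard := by
  classical
  have h : {p : G × G | p.2 ∈ S ∧ Commute p.1 p.2}
      = ((Finset.univ : Finset G).sigma fun g => (commSet S g).toFinite.toFinset).map
        (Equiv.sigmaEquivProd G G).toEmbedding := by
    ext ⟨a, b⟩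
    simp [commSet]
  rw [h, Set.ncard_coe_finset, Finset.card_map, Finset.card_sigma]
  exact Finset.sum_congr rfl fun g _ => Set.ncard_eq_toFinset_card _ _

theorem commCount_univ :
    commCount (Set.univ : Set G) = Nat.card (ConjClasses G) * Nat.card G := by
  rw [commCount_eq_ncard, ← card_comm_eq_card_conjClasses_mul_card, ← Nat.card_coe_set_eq]
  simp only [Set.mem_univ, true_and]
  rfl

theorem commCount_union {S T : Set G} (h : Disjoint S T) :
    commCount (S ∪ T) = commCount S + commCount T := by
  rw [commCount, commCount, commCount, ← Finset.sum_add_distrib]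
  refine Finset.sum_congr rfl fun g _ => ?_
  rw [← Set.ncard_union_eq]
  · congr 1
    ext x
    simp only [commSet, Set.mem_ofPred_eq, Set.mem_union]
    tauto
  · exact Set.disjoint_left.2 fun x hx hy => Set.disjoint_left.1 h hx.1 hy.1

/-- A conjugation invariant set on which a class function takes `n` values meets at least `n`
conjugacy classes. -/
theorem ncard_image_mul_card_le_commCount {X : Type*} {S : Set G}
    (hS : ∀ g, ∀ x ∈ S, g * x * g⁻¹ ∈ S)
    (f : G → X) (hf : ∀ g, ∀ x ∈ S, f (g * x * g⁻¹) = f x) :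
    (f '' S).ncard * Nat.card G ≤ commCount S := by
  classical
  rw [commCount_eq_ncard, ← Set.ncard_univ, ← Set.ncard_prod]
  have h1 : ∀ y : X, ∃ x : G, y ∈ f '' S → x ∈ S ∧ f x = y := by
    intro y
    by_cases hy : y ∈ f '' S
    · obtain ⟨x, hx⟩ := hy
      exact ⟨x, fun _ => hx⟩
    · exact ⟨1, fun h => absurd h hy⟩
  choose r hr using h1
  have h2 : ∀ a x : G, ∃ h : G, (∃ g, g * a * g⁻¹ = x) → h * a * h⁻¹ = x := by
    intro a x
    by_cases hx : ∃ g, g * a * g⁻¹ = x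
    · obtain ⟨g, hg⟩ := hx
      exact ⟨g, fun _ => hg⟩
    · exact ⟨1, fun h => absurd h hx⟩
  choose t ht using h2
  refine Set.ncard_le_ncard_of_injOn
    (fun p : X × G => (p.2 * (t (r p.1) (p.2 * r p.1 * p.2⁻¹))⁻¹, p.2 * r p.1 * p.2⁻¹)) ?_ ?_
  · rintro ⟨y, g⟩ ⟨hy, -⟩
    obtain ⟨h3, h4⟩ := hr y hy
    refine ⟨hS _ _ h3, ?_⟩
    have h5 := ht (r y) (g * r y * g⁻¹) ⟨g, rfl⟩
    set x := g * r y * g⁻¹ with hx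
    set u := t (r y) x
    change g * u⁻¹ * x = x * (g * u⁻¹)
    calc g * u⁻¹ * x = g * u⁻¹ * (u * r y * u⁻¹) := by rw [h5]
      _ = (g * r y * g⁻¹) * (g * u⁻¹) := by group
      _ = x * (g * u⁻¹) := by rw [hx]
  · rintro ⟨y, g⟩ ⟨hy, -⟩ ⟨y', g'⟩ ⟨hy', -⟩ h
    simp only [Prod.mk.injEq] at h
    obtain ⟨h6, h7⟩ := h
    obtain ⟨h3, h4⟩ := hr y hy
    obtain ⟨h3', h4'⟩ := hr y' hy'
    have hyy : y = y' := by
      rw [← h4, ← h4', ← hf g _ h3, ← hf g' _ h3', h7]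
    subst hyy
    rw [h7] at h6
    exact Prod.ext rfl (mul_right_cancel h6)

theorem card_le_commCount {S : Set G} (hS : ∀ g, ∀ x ∈ S, g * x * g⁻¹ ∈ S)
    (hne : S.Nonempty) : Nat.card G ≤ commCount S := by
  have h := ncard_image_mul_card_le_commCount hS (fun _ => ()) (fun _ _ _ => rfl)
  rwa [hne.image_const, Set.ncard_singleton, one_mul] at h

/-- If `A` lies in the kernel of `π`, then the centralizer of `g` has at least `|C_A(g)| o(π g)`
elements. -/
theorem ncard_commSet_mul_orderOf_le {H : Type*} [Group H] (π : G →* H) {A : Subgroup G}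
    (hA : A ≤ π.ker) (g : G) :
    (commSet (A : Set G) g).ncard * orderOf (π g) ≤ (commSet (Set.univ : Set G) g).ncard := by
  have h0 : orderOf (π g) = (Set.Iio (orderOf (π g))).ncard := by
    simp [Set.ncard_eq_toFinset_card']
  rw [h0, ← Set.ncard_prod]
  refine Set.ncard_le_ncard_of_injOn (fun p : G × ℕ => p.1 * g ^ p.2) ?_ ?_
  · rintro ⟨a, i⟩ ⟨ha, -⟩
    exact ⟨trivial, ha.2.mul_right (Commute.pow_right rfl _)⟩
  · rintro ⟨a, i⟩ ⟨ha, hi⟩ ⟨b, j⟩ ⟨hb, hj⟩ h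
    simp only at h hi hj ha hb
    have h1 : π g ^ i = π g ^ j := by
      have := congrArg π h
      simpa [hA ha.1, hA hb.1, MonoidHom.mem_ker.1 (hA ha.1), MonoidHom.mem_ker.1 (hA hb.1)]
        using this
    have h2 : i = j := pow_injOn_Iio_orderOf hi hj h1
    subst h2
    exact Prod.ext (mul_right_cancel h) rfl

end Counting

section Chain

/-- The order of the preimage of a subgroup of a quotient group. -/
theorem Subgroup.card_comap_mk' {G : Type*} [Group G] [Finite G] (D : Subgroup G) [D.Normal]
    (W : Subgroup (G ⧸ D)) :
    Nat.card (W.comap (QuotientGroup.mk' D)) = Nat.card W * Nat.card D := by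
  have h1 := Subgroup.index_comap_of_surjective W (QuotientGroup.mk'_surjective D)
  have h2 := (W.comap (QuotientGroup.mk' D)).card_mul_index
  have h3 := W.card_mul_index
  have h4 : Nat.card (G ⧸ D) * Nat.card D = Nat.card G := by
    rw [mul_comm]; exact D.card_mul_index
  have h5 : W.index ≠ 0 := Subgroup.index_ne_zero_of_finite
  rw [h1] at h2
  rw [← h3] at h4
  refine mul_right_cancel₀ h5 ?_
  rw [h2, ← h4]
  ring

/-- The order of the image of a subgroup in a quotient group. -/
theorem Subgroup.card_map_mk'_mul {G : Type*} [Group G] [Finite G] {D A : Subgroup G} [D.Normal]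
    (h : D ≤ A) : Nat.card (A.map (QuotientGroup.mk' D)) * Nat.card D = Nat.card A := by
  rw [← Subgroup.card_comap_mk', Subgroup.comap_map_eq, QuotientGroup.ker_mk', sup_of_le_left h]

theorem Subgroup.conj_mem_sdiff {G : Type*} [Group G] {A D : Subgroup G} [hA : A.Normal]
    [hD : D.Normal] (g x : G)
    (hx : x ∈ (A : Set G) \ D) : g * x * g⁻¹ ∈ (A : Set G) \ D :=
  ⟨hA.conj_mem x hx.1 g, fun h => hx.2 (by simpa [mul_assoc] using hD.conj_mem _ h g⁻¹)⟩
/-- In a finite `p`-group, normal subgroups `D < A` can be refined by a normal subgroup in which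
`D` has index `p`. -/
theorem IsPGroup.exists_normal_card_eq_mul {p : ℕ} [hp : Fact p.Prime] {G : Type*} [Group G]
    [Finite G] (hG : IsPGroup p G) {D A : Subgroup G} [D.Normal] [A.Normal] (h : D < A) :
    ∃ B : Subgroup G, B.Normal ∧ D < B ∧ B ≤ A ∧ Nat.card B = p * Nat.card D := by
  set q := QuotientGroup.mk' D with hq
  have hQ : IsPGroup p (G ⧸ D) := hG.to_quotient D
  have hAn : (A.map q).Normal := Subgroup.Normal.map inferInstance q (QuotientGroup.mk'_surjective D)
  have hAne : Nontrivial (A.map q) := by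
    rw [Subgroup.nontrivial_iff_ne_bot]
    intro hb
    rw [Subgroup.map_eq_bot_iff, hq, QuotientGroup.ker_mk'] at hb
    exact absurd hb (not_le_of_gt h)
  -- a central element of order `p` in the image of `A`
  have h1 : ∃ z : G ⧸ D, z ∈ A.map q ∧ z ∈ Subgroup.center (G ⧸ D) ∧ z ≠ 1 := by
    have hP : IsPGroup p (ConjAct (G ⧸ D)) := hQ
    have hcard : p ∣ Nat.card (A.map q) := by
      obtain ⟨n, hn⟩ := IsPGroup.iff_card.1 (hQ.to_subgroup (A.map q))
      have : 1 < Nat.card (A.map q) := Finite.one_lt_card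
      rw [hn] at this ⊢
      exact dvd_pow_self p (by rintro rfl; simp at this)
    obtain ⟨b, hb, hb1⟩ := hP.exists_fixed_point_of_prime_dvd_card_of_fixed_point (A.map q) hcard
      (a := 1) (by intro g; simp)
    refine ⟨b, b.2, ?_, fun h => hb1 (Subtype.ext h.symm)⟩
    rw [Subgroup.mem_center_iff]
    intro g
    have := congrArg Subtype.val (hb (ConjAct.toConjAct g))
    rw [ConjAct.Subgroup.val_conj_smul, ConjAct.toConjAct_smul] at this
    exact (mul_inv_eq_iff_eq_mul.1 this)
  obtain ⟨z, hzA, hzc, hz1⟩ := h1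
  obtain ⟨w, hwz, hw⟩ : ∃ w ∈ Subgroup.zpowers z, orderOf w = p := by
    have hcard : p ∣ Nat.card (Subgroup.zpowers z) := by
      obtain ⟨n, hn⟩ := IsPGroup.iff_card.1 (hQ.to_subgroup (Subgroup.zpowers z))
      have : Nontrivial (Subgroup.zpowers z) := by
        rw [Subgroup.nontrivial_iff_ne_bot, Ne, Subgroup.zpowers_eq_bot]; exact hz1
      have : 1 < Nat.card (Subgroup.zpowers z) := Finite.one_lt_card
      rw [hn] at this ⊢
      exact dvd_pow_self p (by rintro rfl; simp at this)
    obtain ⟨w, hw⟩ := exists_prime_orderOf_dvd_card' p hcard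
    exact ⟨w, w.2, by rw [← hw, Subgroup.orderOf_coe]⟩
  have hwA : w ∈ A.map q := (Subgroup.zpowers_le.2 hzA) hwz
  have hwc : w ∈ Subgroup.center (G ⧸ D) := (Subgroup.zpowers_le.2 hzc) hwz
  have hWn : (Subgroup.zpowers w).Normal := by
    constructor
    intro n hn g
    have : n ∈ Subgroup.center (G ⧸ D) := (Subgroup.zpowers_le.2 hwc) hn
    rw [Subgroup.mem_center_iff.1 this g]
    simpa using hn
  have hDle : D ≤ (Subgroup.zpowers w).comap q := by
    intro x hx
    rw [Subgroup.mem_comap]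
    have : q x = 1 := (QuotientGroup.eq_one_iff x).2 hx
    rw [this]; exact one_mem _
  have hcard : Nat.card ((Subgroup.zpowers w).comap q) = p * Nat.card D := by
    rw [hq, Subgroup.card_comap_mk', Nat.card_zpowers, hw]
  refine ⟨(Subgroup.zpowers w).comap q, inferInstance, lt_of_le_of_ne hDle ?_, ?_, hcard⟩
  · intro e
    rw [← e] at hcard
    have h2 := hp.out.two_le
    have : 0 < Nat.card D := Nat.card_pos
    nlinarith
  · have : (Subgroup.zpowers w).comap q ≤ (A.map q).comap q :=
      Subgroup.comap_mono (Subgroup.zpowers_le.2 hwA)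
    refine this.trans ?_
    rw [Subgroup.comap_map_eq, hq, QuotientGroup.ker_mk']
    exact sup_le le_rfl h.le

/-- A difference of normal subgroups `D ≤ A` of a `p`-group meets at least `log_p |A : D|`
conjugacy classes. -/
theorem IsPGroup.mul_card_le_commCount_diff {p : ℕ} [hp : Fact p.Prime] {G : Type*} [Group G]
    [Fintype G] (hG : IsPGroup p G) {A : Subgroup G} [hA : A.Normal] (r : ℕ) :
    ∀ {D : Subgroup G} [D.Normal], D ≤ A → p ^ r * Nat.card D ≤ Nat.card A →
      r * Nat.card G ≤ commCount ((A : Set G) \ D) := by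
  induction r with
  | zero => intro D _ _ _; simp
  | succ r ih =>
    intro D hD hDA hc
    have hlt : D < A := by
      refine lt_of_le_of_ne hDA ?_
      rintro rfl
      have h2 : 1 < p ^ (r + 1) := Nat.one_lt_pow (by simp) hp.out.one_lt
      have : 0 < Nat.card D := Nat.card_pos
      nlinarith
    obtain ⟨B, hB, hDB, hBA, hBc⟩ := hG.exists_normal_card_eq_mul hlt
    have h1 := ih hBA (by rw [hBc, ← mul_assoc, ← pow_succ]; exact hc)
    have h2 : Nat.card G ≤ commCount ((B : Set G) \ D) :=
      card_le_commCount (fun g x hx => Subgroup.conj_mem_sdiff g x hx) (Set.nonempty_of_ssubset hDB)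
    have h3 : ((A : Set G) \ D) = ((A : Set G) \ B) ∪ ((B : Set G) \ D) := by
      rw [Set.sdiff_union_sdiff_cancel] <;> [exact hBA; exact hDB.le]
    rw [h3, commCount_union]
    · rw [add_mul, one_mul]; exact add_le_add h1 h2
    · exact Set.disjoint_left.2 fun x hx hy => hx.2 hy.1

end Chain

section Block

/-- A nilpotent endomorphism `T` satisfies `|V| ≤ |ker T| ^ n` if `T ^ n = 0`. -/
theorem AddMonoid.End.ncard_ker_pow_le {V : Type*} [AddCommGroup V] [Finite V]
    (T : AddMonoid.End V) (n : ℕ) :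
    {v | (T ^ n) v = 0}.ncard ≤ {v | T v = 0}.ncard ^ n := by
  induction n with
  | zero => simp
  | succ n ih =>
    have h1 : ∀ w : V, ∃ v : V, (∃ u, T u = w) → T v = w := by
      intro w
      by_cases hw : ∃ u, T u = w
      · exact ⟨hw.choose, fun _ => hw.choose_spec⟩
      · exact ⟨0, fun h => absurd h hw⟩
    choose s hs using h1
    have hs' : ∀ v, T (s (T v)) = T v := fun v => hs _ ⟨v, rfl⟩
    rw [pow_succ]
    refine le_trans ?_ (Nat.mul_le_mul_right _ ih)
    rw [← Set.ncard_prod]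
    refine Set.ncard_le_ncard_of_injOn (fun v => (T v, v - s (T v))) ?_ ?_
    · intro v hv
      refine ⟨?_, ?_⟩
      · exact hv
      · simp [hs']
    · intro v _ w _ h
      simp only [Prod.mk.injEq] at h
      obtain ⟨h1, h2⟩ := h
      rw [h1] at h2
      simpa using h2

theorem AddMonoid.End.card_le_ncard_fixed_pow {p : ℕ} [hp : Fact p.Prime] {V : Type*}
    [AddCommGroup V] [Finite V] (hV : ∀ v : V, p • v = 0) (σ : AddMonoid.End V) (e : ℕ)
    (h : σ ^ p ^ e = 1) : Nat.card V ≤ {v | σ v = v}.ncard ^ p ^ e := by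
  have h1 : (p : AddMonoid.End V) = 0 := by
    ext v
    rw [AddMonoid.End.natCast_apply]
    exact hV v
  obtain ⟨r, hr⟩ := Commute.exists_add_pow_prime_pow_eq hp.out
    (Commute.one_right (σ - 1)) e
  rw [sub_add_cancel, h, h1, zero_mul, zero_mul, zero_mul, add_zero, one_pow, right_eq_add] at hr
  have h2 := AddMonoid.End.ncard_ker_pow_le (σ - 1) (p ^ e)
  rw [hr] at h2
  have h3 : {v : V | (0 : AddMonoid.End V) v = 0} = Set.univ := by
    ext v; simp
  rw [h3, Set.ncard_univ] at h2
  convert h2 using 5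
  exact sub_eq_zero.symm

/-- An automorphism of order `n` of an elementary abelian `p`-group, `n` a power of `p`, has at
least `|A| ^ (1 / n)` fixed points. -/
theorem card_le_ncard_commSet_pow {p : ℕ} [hp : Fact p.Prime] {G : Type*} [Group G] [Finite G]
    (hG : IsPGroup p G) {A : Subgroup G} [A.Normal] (hc : ∀ x ∈ A, ∀ y ∈ A, x * y = y * x)
    (hx : ∀ x ∈ A, x ^ p = 1) (g : G) :
    Nat.card A ≤ (commSet (A : Set G) g).ncard ^
      orderOf (MulAut.conjNormal g : MulAut A) := by
  let _ : CommGroup A :=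
    { (inferInstance : Group A) with mul_comm := fun x y => Subtype.ext (hc x x.2 y y.2) }
  obtain ⟨e, he⟩ : ∃ e, orderOf (MulAut.conjNormal g : MulAut A) = p ^ e := by
    obtain ⟨n, hn⟩ := hG g
    have : orderOf (MulAut.conjNormal g : MulAut A) ∣ p ^ n :=
      orderOf_dvd_of_pow_eq_one (by rw [← map_pow, hn, map_one])
    obtain ⟨e, -, he⟩ := (Nat.dvd_prime_pow hp.out).1 this
    exact ⟨e, he⟩
  have hs := pow_orderOf_eq_one (MulAut.conjNormal g : MulAut A)
  rw [he] at hs ⊢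
  set τ : MulAut A := MulAut.conjNormal g with hτ
  let σ : AddMonoid.End (Additive A) := MonoidHom.toAdditive τ.toMonoidHom
  have hσ : ∀ n v, (σ ^ n) v = Additive.ofMul ((τ ^ n) (Additive.toMul v)) := by
    intro n
    induction n with
    | zero => intro v; rfl
    | succ n ih =>
      intro v
      rw [pow_succ, pow_succ]
      exact ih (σ v)
  have h1 := AddMonoid.End.card_le_ncard_fixed_pow (p := p) (V := Additive A)
    (fun v => Subtype.ext (hx (Additive.toMul v : A) (Additive.toMul v : A).2)) σ e
    (by ext v; rw [hσ, hs]; rfl)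
  refine h1.trans (Nat.pow_le_pow_left ?_ _)
  refine Set.ncard_le_ncard_of_injOn (fun v => ((Additive.toMul v : A) : G)) ?_ ?_
  · intro v hv
    refine ⟨(Additive.toMul v : A).2, ?_⟩
    have h2 : τ (Additive.toMul v) = Additive.toMul v := hv
    have h3 := congrArg Subtype.val h2
    rw [hτ, MulAut.conjNormal_apply] at h3
    exact mul_inv_eq_iff_eq_mul.1 h3
  · intro v _ w _ h
    exact Subtype.ext h

end Block

section HarmonicBound

/-- The weight function `∑_{j=1}^c (p^j - p^{j-1}) / j`. -/
noncomputable def harmonicWeight (p c : ℕ) : ℝ :=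
  ∑ j ∈ Finset.range c, ((p : ℝ) ^ (j + 1) - (p : ℝ) ^ j) / (j + 1)

theorem mul_harmonicWeight_le {p : ℕ} (hp : 2 ≤ p) (c : ℕ) :
    c * harmonicWeight p c ≤ 4 * (p : ℝ) ^ c := by
  have hp' : (2 : ℝ) ≤ p := by exact_mod_cast hp
  induction c with
  | zero => simp
  | succ c ih =>
    rw [harmonicWeight, Finset.sum_range_succ, ← harmonicWeight]
    push_cast
    have hc : ((c : ℝ) + 1) ≠ 0 := by positivity
    rw [mul_add, mul_div_cancel₀ _ hc]
    have hpc : (0 : ℝ) < (p : ℝ) ^ c := by positivity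
    rcases Nat.lt_or_ge c 2 with h | h
    · interval_cases c
      · simp [harmonicWeight]; linarith
      · simp [harmonicWeight]; nlinarith
    · have hc2 : (2 : ℝ) ≤ c := by exact_mod_cast h
      have h0 : harmonicWeight p c * 2 ≤ 4 * (p : ℝ) ^ c := by
        refine le_trans ?_ ih
        rw [mul_comm]
        refine mul_le_mul_of_nonneg_right hc2 ?_
        refine Finset.sum_nonneg fun j _ => div_nonneg ?_ (by positivity)
        rw [pow_succ]
        nlinarith [pow_pos (show (0 : ℝ) < p by linarith) j]
      rw [pow_succ]
      nlinarith

theorem harmonicWeight_diff {p : ℕ} (hp : 2 ≤ p) {c d f : ℕ} (hcd : c ≤ d) (hdf : d ≤ f)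
    (hf : 0 < f) :
    ((p : ℝ) ^ d - (p : ℝ) ^ c) / f ≤ harmonicWeight p d - harmonicWeight p c := by
  have hp' : (2 : ℝ) ≤ p := by exact_mod_cast hp
  have hf' : (0 : ℝ) < f := by exact_mod_cast hf
  induction d, hcd using Nat.le_induction with
  | base => simp
  | succ d hcd ih =>
    have h1 := ih (by omega)
    rw [harmonicWeight, Finset.sum_range_succ, ← harmonicWeight]
    have h2 : ((p : ℝ) ^ (d + 1) - (p : ℝ) ^ d) / f
        ≤ ((p : ℝ) ^ (d + 1) - (p : ℝ) ^ d) / (d + 1) := by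
      refine div_le_div_of_nonneg_left ?_ (by positivity) (by exact_mod_cast hdf)
      rw [pow_succ]
      nlinarith [pow_pos (show (0 : ℝ) < p by linarith) d]
    have h3 : ((p : ℝ) ^ (d + 1) - (p : ℝ) ^ c) / f
        = ((p : ℝ) ^ (d + 1) - (p : ℝ) ^ d) / f + ((p : ℝ) ^ d - (p : ℝ) ^ c) / f := by
      rw [← add_div]; ring_nf
    linarith

theorem commSet_eq_coe {G : Type*} [Group G] (B : Subgroup G) (g : G) :
    commSet (B : Set G) g = ((B ⊓ Subgroup.centralizer {g} : Subgroup G) : Set G) := by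
  ext x
  simp [commSet, Subgroup.mem_centralizer_singleton_iff, Commute, SemiconjBy, eq_comm]

theorem IsPGroup.ncard_commSet {p : ℕ} [hp : Fact p.Prime] {G : Type*} [Group G] [Finite G]
    (hG : IsPGroup p G) (B : Subgroup G) (g : G) :
    (commSet (B : Set G) g).ncard = p ^ Nat.log p (commSet (B : Set G) g).ncard := by
  obtain ⟨n, hn⟩ := IsPGroup.iff_card.1 (hG.to_subgroup (B ⊓ Subgroup.centralizer {g}))
  have : (commSet (B : Set G) g).ncard = p ^ n := by
    rw [commSet_eq_coe, ← hn]
    exact (Nat.card_coe_set_eq _).symm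
  rw [this, Nat.log_pow hp.out.one_lt]

theorem IsPGroup.exists_sum_harmonicWeight {p : ℕ} [hp : Fact p.Prime] {G : Type*} [Group G]
    [Fintype G] (hG : IsPGroup p G) {A : Subgroup G} [A.Normal] {r : ℕ}
    (hr : Nat.card A = p ^ r) (f : ℕ) (hf : f ≤ r) :
    ∃ B : Subgroup G, B.Normal ∧ B ≤ A ∧ Nat.card B = p ^ f ∧
      Nat.card G * (harmonic f : ℝ)
        ≤ ∑ g : G, harmonicWeight p (Nat.log p (commSet (B : Set G) g).ncard) := by
  induction f with
  | zero =>
    refine ⟨⊥, inferInstance, bot_le, by simp, ?_⟩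
    simp only [harmonic_zero, Rat.cast_zero, mul_zero]
    refine Finset.sum_nonneg fun g _ => Finset.sum_nonneg fun j _ => div_nonneg ?_ (by positivity)
    have hp' : (2 : ℝ) ≤ p := by exact_mod_cast hp.out.two_le
    rw [pow_succ]
    nlinarith [pow_pos (show (0 : ℝ) < p by linarith) j]
  | succ f ih =>
    obtain ⟨B, hB, hBA, hBc, hsum⟩ := ih (by omega)
    have hlt : B < A := by
      refine lt_of_le_of_ne hBA ?_
      rintro rfl
      rw [hBc] at hr
      have := Nat.pow_right_injective hp.out.two_le hr
      omega
    obtain ⟨E, hE, hBE, hEA, hEc⟩ := hG.exists_normal_card_eq_mul hlt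
    rw [hBc, ← pow_succ'] at hEc
    refine ⟨E, hE, hEA, hEc, ?_⟩
    have h1 : commCount (E : Set G) = commCount ((E : Set G) \ B) + commCount (B : Set G) := by
      rw [← commCount_union Set.disjoint_sdiff_left, Set.sdiff_union_of_subset hBE.le]
    have h2 : Nat.card G ≤ commCount ((E : Set G) \ B) :=
      card_le_commCount (fun g x hx => Subgroup.conj_mem_sdiff g x hx)
        (Set.nonempty_of_ssubset hBE)
    have h3 : (Nat.card G : ℝ) ≤ commCount (E : Set G) - commCount (B : Set G) := by
      rw [h1]; push_cast; have : (Nat.card G : ℝ) ≤ commCount ((E : Set G) \ B) := by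
        exact_mod_cast h2
      linarith
    have h4 : ∀ g : G, (((commSet (E : Set G) g).ncard : ℝ) - (commSet (B : Set G) g).ncard)
          / (f + 1 : ℕ) ≤
        harmonicWeight p (Nat.log p (commSet (E : Set G) g).ncard) -
          harmonicWeight p (Nat.log p (commSet (B : Set G) g).ncard) := by
      intro g
      have e1 := hG.ncard_commSet E g
      have e2 := hG.ncard_commSet B g
      have h5 : (commSet (B : Set G) g).ncard ≤ (commSet (E : Set G) g).ncard :=
        Set.ncard_le_ncard fun x hx => ⟨hBE.le hx.1, hx.2⟩
      have h6 : (commSet (E : Set G) g).ncard ≤ p ^ (f + 1) := by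
        rw [← hEc, ← SetLike.coe_sort_coe, Nat.card_coe_set_eq]
        exact Set.ncard_le_ncard fun x hx => hx.1
      have h7 := harmonicWeight_diff hp.out.two_le (Nat.log_mono_right (b := p) h5)
        (f := f + 1) (by
          have := Nat.log_mono_right (b := p) h6
          rwa [Nat.log_pow hp.out.one_lt] at this) (by omega)
      rw [← Nat.cast_pow, ← Nat.cast_pow, ← e1, ← e2] at h7
      exact h7
    have h8 := Finset.sum_le_sum fun g (_ : g ∈ Finset.univ) => h4 g
    rw [← Finset.sum_div, Finset.sum_sub_distrib, Finset.sum_sub_distrib, ← Nat.cast_sum,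
      ← Nat.cast_sum] at h8
    have h9 : (Nat.card G : ℝ) / (f + 1 : ℕ) ≤
        ((commCount (E : Set G) : ℝ) - commCount (B : Set G)) / (f + 1 : ℕ) := by
      gcongr
    rw [harmonic_succ]
    push_cast at h8 h9 ⊢
    rw [mul_add, ← div_eq_mul_inv]
    unfold commCount at h9
    push_cast at h9
    linarith

/-- A `p`-group with an elementary abelian normal subgroup of rank `r` has at least `r H_r / 4`
conjugacy classes. -/
theorem IsPGroup.mul_harmonic_le {p : ℕ} [hp : Fact p.Prime] {G : Type*} [Group G]
    [Finite G] (hG : IsPGroup p G) {A : Subgroup G} [A.Normal]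
    (hc : ∀ x ∈ A, ∀ y ∈ A, x * y = y * x) (hx : ∀ x ∈ A, x ^ p = 1) {r : ℕ}
    (hr : Nat.card A = p ^ r) :
    r * (harmonic r : ℝ) ≤ 4 * Nat.card (ConjClasses G) := by
  have := Fintype.ofFinite G
  obtain ⟨B, hB, hBA, hBc, hsum⟩ := hG.exists_sum_harmonicWeight hr r le_rfl
  obtain rfl : B = A := Subgroup.eq_of_le_of_card_ge hBA (by rw [hBc, hr])
  have h1 : ∀ g : G, r * harmonicWeight p (Nat.log p (commSet (B : Set G) g).ncard) ≤
      4 * (commSet (Set.univ : Set G) g).ncard := by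
    intro g
    set c := Nat.log p (commSet (B : Set G) g).ncard with hcdef
    have e1 : (commSet (B : Set G) g).ncard = p ^ c := hG.ncard_commSet B g
    have h2 := card_le_ncard_commSet_pow hG hc hx g
    have h3 := ncard_commSet_mul_orderOf_le (MulAut.conjNormal : G →* MulAut B) (A := B) (by
      intro a ha
      rw [MonoidHom.mem_ker]
      ext ⟨b, hb⟩
      simp only [MulAut.conjNormal_apply, MulAut.one_apply]
      rw [hc a ha b hb, mul_inv_cancel_right]) g
    set o := orderOf (MulAut.conjNormal g : MulAut B)
    rw [hr, e1, ← pow_mul] at h2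
    have h4 : r ≤ c * o := (Nat.pow_le_pow_iff_right hp.out.one_lt).1 h2
    have h5 := mul_harmonicWeight_le hp.out.two_le c
    have h6 : (0 : ℝ) ≤ harmonicWeight p c :=
      Finset.sum_nonneg fun j _ => div_nonneg (by
        have hp' : (2 : ℝ) ≤ p := by exact_mod_cast hp.out.two_le
        rw [pow_succ]
        nlinarith [pow_pos (show (0 : ℝ) < p by linarith) j]) (by positivity)
    rw [e1] at h3
    have h3' : (p : ℝ) ^ c * o ≤ (commSet (Set.univ : Set G) g).ncard := by exact_mod_cast h3
    have h4' : (r : ℝ) ≤ c * o := by exact_mod_cast h4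
    have ho : (0 : ℝ) ≤ o := by positivity
    calc r * harmonicWeight p c ≤ (c * o) * harmonicWeight p c := by gcongr
      _ = o * (c * harmonicWeight p c) := by ring
      _ ≤ o * (4 * (p : ℝ) ^ c) := by gcongr
      _ = 4 * ((p : ℝ) ^ c * o) := by ring
      _ ≤ _ := by gcongr
  have h2 := Finset.sum_le_sum fun g (_ : g ∈ Finset.univ) => h1 g
  rw [← Finset.mul_sum, ← Finset.mul_sum, ← Nat.cast_sum] at h2
  have h3 : (∑ g : G, (commSet (Set.univ : Set G) g).ncard)
      = Nat.card (ConjClasses G) * Nat.card G := commCount_univ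
  rw [h3] at h2
  push_cast at h2
  have hpos : (0 : ℝ) < Nat.card G := by exact_mod_cast Nat.card_pos
  have hr0 : (0 : ℝ) ≤ r := by positivity
  refine le_of_mul_le_mul_right ?_ hpos
  calc r * (harmonic r : ℝ) * Nat.card G = r * (Nat.card G * (harmonic r : ℝ)) := by ring
    _ ≤ _ := by gcongr
    _ ≤ _ := h2
    _ = _ := by ring

end HarmonicBound

section PowerSubgroups

variable {G : Type*} [Group G]

/-- The subgroup of `n`-th powers of elements of a commutative subgroup `M`. -/
def powSubgroup (M : Subgroup G) (hc : ∀ x ∈ M, ∀ y ∈ M, x * y = y * x) (n : ℕ) :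
    Subgroup G where
  carrier := {y | ∃ x ∈ M, x ^ n = y}
  one_mem' := ⟨1, one_mem M, one_pow n⟩
  mul_mem' := by
    rintro _ _ ⟨x, hx, rfl⟩ ⟨y, hy, rfl⟩
    exact ⟨x * y, mul_mem hx hy, Commute.mul_pow (hc x hx y hy) n⟩
  inv_mem' := by
    rintro _ ⟨x, hx, rfl⟩
    exact ⟨x⁻¹, inv_mem hx, inv_pow x n⟩

/-- The subgroup of elements of a commutative subgroup `M` killed by `n`. -/
def torsionSubgroup (M : Subgroup G) (hc : ∀ x ∈ M, ∀ y ∈ M, x * y = y * x) (n : ℕ) :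
    Subgroup G where
  carrier := {x | x ∈ M ∧ x ^ n = 1}
  one_mem' := ⟨one_mem M, one_pow n⟩
  mul_mem' := by
    rintro x y ⟨hx, hx'⟩ ⟨hy, hy'⟩
    exact ⟨mul_mem hx hy, by rw [Commute.mul_pow (hc x hx y hy), hx', hy', one_mul]⟩
  inv_mem' := by
    rintro x ⟨hx, hx'⟩
    exact ⟨inv_mem hx, by rw [inv_pow, hx', inv_one]⟩

variable {M : Subgroup G} {hc : ∀ x ∈ M, ∀ y ∈ M, x * y = y * x}

theorem mem_powSubgroup {n : ℕ} {y : G} : y ∈ powSubgroup M hc n ↔ ∃ x ∈ M, x ^ n = y :=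
  Iff.rfl

theorem mem_torsionSubgroup {n : ℕ} {x : G} : x ∈ torsionSubgroup M hc n ↔ x ∈ M ∧ x ^ n = 1 :=
  Iff.rfl

theorem powSubgroup_le (n : ℕ) : powSubgroup M hc n ≤ M := by
  rintro _ ⟨x, hx, rfl⟩
  exact pow_mem hx n

theorem powSubgroup_le_powSubgroup {m n : ℕ} (h : m ∣ n) :
    powSubgroup M hc n ≤ powSubgroup M hc m := by
  obtain ⟨d, rfl⟩ := h
  rintro _ ⟨x, hx, rfl⟩
  exact ⟨x ^ d, pow_mem hx d, by rw [← pow_mul, mul_comm]⟩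

instance powSubgroup_normal [hM : M.Normal] (n : ℕ) : (powSubgroup M hc n).Normal := by
  constructor
  rintro _ ⟨x, hx, rfl⟩ g
  exact ⟨g * x * g⁻¹, hM.conj_mem x hx g, conj_pow⟩

instance torsionSubgroup_normal [hM : M.Normal] (n : ℕ) : (torsionSubgroup M hc n).Normal := by
  constructor
  rintro x ⟨hx, hx'⟩ g
  exact ⟨hM.conj_mem x hx g, by rw [conj_pow, hx', mul_one, mul_inv_cancel]⟩

theorem card_powSubgroup_mul_card_torsionSubgroup [Finite G] (n : ℕ) :
    Nat.card (powSubgroup M hc n) * Nat.card (torsionSubgroup M hc n) = Nat.card M := by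
  let φ : M →* G := MonoidHom.mk' (fun x => (x : G) ^ n)
    (fun x y => Commute.mul_pow (hc x x.2 y y.2) n)
  have h1 : Nat.card φ.range = Nat.card (powSubgroup M hc n) := by
    congr 1
    have : φ.range = powSubgroup M hc n := by
      ext y
      simp [φ, MonoidHom.mem_range, mem_powSubgroup]
    rw [this]
  have h2 : Nat.card φ.ker = Nat.card (torsionSubgroup M hc n) := by
    have : torsionSubgroup M hc n = φ.ker.map M.subtype := by
      ext y
      simp [φ, MonoidHom.mem_ker, mem_torsionSubgroup, and_comm]
    rw [this]
    exact Nat.card_congr (φ.ker.equivMapOfInjective _ M.subtype_injective).toEquiv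
  rw [← φ.ker.card_mul_index, Subgroup.index_ker, h1, h2, mul_comm]

end PowerSubgroups

section LargeExponent

/-- A `p`-group with an abelian normal subgroup having `ρ` composition factors at a high level
of its power series has many conjugacy classes. -/
theorem IsPGroup.pow_mul_le {p : ℕ} [hp : Fact p.Prime] {G : Type*} [Group G]
    [Finite G] (hG : IsPGroup p G) {M : Subgroup G} [hM : M.Normal]
    (hc : ∀ x ∈ M, ∀ y ∈ M, x * y = y * x) {s b ρ : ℕ}
    (hexp : ∀ x ∈ M, x ^ p ^ (2 * s) = 1)
    (hρ : Nat.card (powSubgroup M hc (p ^ (s + b))) = p ^ ρ) :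
    p ^ (b + 1) * ρ ≤ 2 * Nat.card (ConjClasses G) := by
  classical
  have := Fintype.ofFinite G
  set A := powSubgroup M hc (p ^ s) with hA
  set K := torsionSubgroup M hc (p ^ s) with hK
  have hAM : A ≤ M := powSubgroup_le _
  have hcA : ∀ x ∈ A, ∀ y ∈ A, x * y = y * x := fun x hx y hy => hc x (hAM hx) y (hAM hy)
  set D := torsionSubgroup A hcA (p ^ b) with hD
  have hDA : D ≤ A := fun x hx => hx.1
  have hAK : A ≤ K := by
    rintro _ ⟨x, hx, rfl⟩
    exact ⟨pow_mem hx _, by rw [← pow_mul, ← pow_add, ← two_mul]; exact hexp x hx⟩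
  have hcard : p ^ ρ * Nat.card D ≤ Nat.card A := by
    rw [← card_powSubgroup_mul_card_torsionSubgroup (hc := hcA) (p ^ b), ← hρ]
    refine Nat.mul_le_mul_right _ (le_of_eq ?_)
    congr 2
    ext y
    constructor
    · rintro ⟨x, hx, rfl⟩
      exact ⟨x ^ p ^ s, ⟨x, hx, rfl⟩, by rw [← pow_mul, pow_add]⟩
    · rintro ⟨_, ⟨x, hx, rfl⟩, rfl⟩
      exact ⟨x, hx, by rw [← pow_mul, pow_add]⟩
  have hcount := hG.mul_card_le_commCount_diff (A := A) ρ hDA hcard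
  set S : G → Set G := commSet ((A : Set G) \ D) with hS
  set bad : Finset G := Finset.univ.filter fun g => (S g).Nonempty ∧ g ^ p ^ b ∈ K with hbad
  set good : Finset G := Finset.univ.filter fun g => (S g).Nonempty ∧ g ^ p ^ b ∉ K with hgood
  -- a choice of a root of an element of `S g`, depending on the set `S g` only
  have hroot : ∀ T : Set G, ∃ y : G, (∃ g, T = S g ∧ (S g).Nonempty) →
      y ∈ M ∧ y ^ p ^ s ∈ T := by
    intro T
    by_cases hT : ∃ g, T = S g ∧ (S g).Nonempty
    · obtain ⟨g, rfl, x, hx⟩ := hT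
      obtain ⟨y, hy, rfl⟩ := hx.1.1
      exact ⟨y, fun _ => ⟨hy, hx⟩⟩
    · exact ⟨1, fun h => absurd h hT⟩
  choose y hy using hroot
  have hSmul : ∀ g, ∀ z ∈ M, S (g * z) = S g := by
    intro g z hz
    ext x
    refine and_congr_right fun hx => ?_
    have hzx : Commute z x := hc z hz x (hAM hx.1)
    constructor
    · intro h
      have := h.mul_left hzx.inv_left
      rwa [mul_inv_cancel_right] at this
    · exact fun h => h.mul_left hzx
  have hmaps : ∀ g ∈ bad, g * y (S g) ∈ good := by
    intro g hg
    rw [hbad, Finset.mem_filter] at hg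
    obtain ⟨-, hne, hgK⟩ := hg
    obtain ⟨hyM, hyS⟩ := hy (S g) ⟨g, rfl, hne⟩
    rw [hgood, Finset.mem_filter, hSmul g _ hyM]
    refine ⟨Finset.mem_univ _, hne, fun hK' => ?_⟩
    set z := y (S g) with hz
    have hcomm : g * z * g⁻¹ * z⁻¹ ∈ K := by
      refine ⟨mul_mem (hM.conj_mem z hyM g) (inv_mem hyM), ?_⟩
      have h1 : Commute (g * z * g⁻¹) z⁻¹ := hc _ (hM.conj_mem z hyM g) _ (inv_mem hyM)
      rw [h1.mul_pow, conj_pow, inv_pow, mul_inv_eq_one]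
      exact mul_inv_eq_iff_eq_mul.2 hyS.2
    have hπ : ∀ x, QuotientGroup.mk' K x = 1 ↔ x ∈ K := fun x => QuotientGroup.eq_one_iff x
    rw [← hπ] at hcomm hK' hgK
    have hq : Commute (QuotientGroup.mk' K g) (QuotientGroup.mk' K z) := by
      rw [map_mul, map_inv, mul_inv_eq_one, map_mul, map_inv, mul_inv_eq_iff_eq_mul,
        map_mul] at hcomm
      exact hcomm
    rw [map_pow, map_mul, hq.mul_pow, ← map_pow, hgK, one_mul, ← map_pow, hπ] at hK'
    have h5 := hK'.2
    refine hyS.1.2 ⟨hyS.1.1, ?_⟩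
    rw [← pow_mul, mul_comm, pow_mul]
    exact h5
  have hinj : Set.InjOn (fun g => g * y (S g)) (bad : Set G) := by
    intro g hg g' hg' h
    rw [hbad, Finset.mem_coe, Finset.mem_filter] at hg hg'
    have h1 := hSmul g _ (hy (S g) ⟨g, rfl, hg.2.1⟩).1
    have h2 := hSmul g' _ (hy (S g') ⟨g', rfl, hg'.2.1⟩).1
    simp only at h
    rw [h, h2] at h1
    rw [h1] at h
    exact mul_right_cancel h
  have hbg : ∑ g ∈ bad, (S g).ncard ≤ ∑ g ∈ good, (S g).ncard := by
    calc ∑ g ∈ bad, (S g).ncard = ∑ g ∈ bad, (S (g * y (S g))).ncard := by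
          refine Finset.sum_congr rfl fun g hg => ?_
          rw [hbad, Finset.mem_filter] at hg
          rw [hSmul g _ (hy (S g) ⟨g, rfl, hg.2.1⟩).1]
      _ = ∑ g ∈ bad.image fun g => g * y (S g), (S g).ncard := by
          rw [Finset.sum_image hinj]
      _ ≤ _ := Finset.sum_le_sum_of_subset (Finset.image_subset_iff.2 hmaps)
  have htot : commCount ((A : Set G) \ D) ≤ ∑ g ∈ bad, (S g).ncard + ∑ g ∈ good, (S g).ncard := by
    rw [commCount, ← Finset.sum_union]
    · refine le_of_eq (Finset.sum_subset (Finset.subset_univ _) fun g _ hg => ?_).symm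
      have : ¬ (S g).Nonempty := by
        intro hne
        apply hg
        simp only [hbad, hgood, Finset.mem_union, Finset.mem_filter, Finset.mem_univ, true_and]
        tauto
      exact (Set.ncard_eq_zero).2 (Set.not_nonempty_iff_eq_empty.1 this)
    · rw [Finset.disjoint_left]
      intro g h1 h2
      rw [hbad, Finset.mem_filter] at h1
      rw [hgood, Finset.mem_filter] at h2
      exact h2.2.2 h1.2.2
  have horder : ∀ g ∈ good, (S g).ncard * p ^ (b + 1) ≤ (commSet (Set.univ : Set G) g).ncard := by
    intro g hg
    rw [hgood, Finset.mem_filter] at hg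
    refine le_trans ?_ (ncard_commSet_mul_orderOf_le (QuotientGroup.mk' K) (A := A)
      (by rwa [QuotientGroup.ker_mk']) g)
    refine Nat.mul_le_mul (Set.ncard_le_ncard fun x hx => ⟨hx.1.1, hx.2⟩) ?_
    obtain ⟨n, hn⟩ := (hG.to_quotient K) (QuotientGroup.mk' K g)
    obtain ⟨e, -, he⟩ := (Nat.dvd_prime_pow hp.out).1 (orderOf_dvd_of_pow_eq_one hn)
    rw [he]
    refine Nat.pow_le_pow_right hp.out.pos ?_
    by_contra hlt
    apply hg.2.2
    have h1 : orderOf (QuotientGroup.mk' K g) ∣ p ^ b := by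
      rw [he]; exact pow_dvd_pow p (by omega)
    have h2 := orderOf_dvd_iff_pow_eq_one.1 h1
    rw [← map_pow] at h2
    exact (QuotientGroup.eq_one_iff _).1 h2
  have hfinal : (∑ g ∈ good, (S g).ncard) * p ^ (b + 1)
      ≤ Nat.card (ConjClasses G) * Nat.card G := by
    rw [← commCount_univ, commCount, Finset.sum_mul]
    refine (Finset.sum_le_sum horder).trans ?_
    exact Finset.sum_le_sum_of_subset (Finset.subset_univ _)
  have hpos : 0 < Nat.card G := Nat.card_pos
  refine Nat.le_of_mul_le_mul_right ?_ hpos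
  have h1 : ρ * Nat.card G ≤ 2 * ∑ g ∈ good, (S g).ncard := by
    have := hcount.trans htot
    omega
  calc p ^ (b + 1) * ρ * Nat.card G = (ρ * Nat.card G) * p ^ (b + 1) := by ring
    _ ≤ (2 * ∑ g ∈ good, (S g).ncard) * p ^ (b + 1) := Nat.mul_le_mul_right _ h1
    _ = 2 * ((∑ g ∈ good, (S g).ncard) * p ^ (b + 1)) := by ring
    _ ≤ 2 * (Nat.card (ConjClasses G) * Nat.card G) := Nat.mul_le_mul_left _ hfinal
    _ = _ := by ring

end LargeExponent

section AbelianNormal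

theorem IsPGroup.card_eq_pow_log {p : ℕ} [hp : Fact p.Prime] {G : Type*} [Group G] [Finite G]
    (hG : IsPGroup p G) : Nat.card G = p ^ Nat.log p (Nat.card G) := by
  obtain ⟨n, hn⟩ := IsPGroup.iff_card.1 hG
  rw [hn, Nat.log_pow hp.out.one_lt]

theorem Subgroup.map_commutes {G H : Type*} [Group G] [Group H] {M : Subgroup G}
    (hc : ∀ x ∈ M, ∀ y ∈ M, x * y = y * x) (f : G →* H) :
    ∀ x ∈ M.map f, ∀ y ∈ M.map f, x * y = y * x := by
  rintro _ ⟨x, hx, rfl⟩ _ ⟨y, hy, rfl⟩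
  rw [← map_mul, hc x hx y hy, map_mul]

theorem powSubgroup_map {G H : Type*} [Group G] [Group H] {M : Subgroup G}
    (hc : ∀ x ∈ M, ∀ y ∈ M, x * y = y * x) (f : G →* H) (n : ℕ) :
    powSubgroup (M.map f) (Subgroup.map_commutes hc f) n = (powSubgroup M hc n).map f := by
  ext y
  constructor
  · rintro ⟨_, ⟨x, hx, rfl⟩, rfl⟩
    exact ⟨x ^ n, ⟨x, hx, rfl⟩, map_pow f x n⟩
  · rintro ⟨_, ⟨x, hx, rfl⟩, rfl⟩
    exact ⟨f x, ⟨x, hx, rfl⟩, (map_pow f x n).symm⟩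

/-- The order of a quotient of subgroups of a `p`-group, in terms of logarithms. -/
theorem IsPGroup.card_map_mk' {p : ℕ} [hp : Fact p.Prime] {G : Type*} [Group G] [Finite G]
    (hG : IsPGroup p G) {D A : Subgroup G} [D.Normal] (h : D ≤ A) :
    Nat.card (A.map (QuotientGroup.mk' D))
      = p ^ (Nat.log p (Nat.card A) - Nat.log p (Nat.card D)) := by
  have h1 := Subgroup.card_map_mk'_mul h
  have hD : 0 < Nat.card D := Nat.card_pos
  refine Nat.eq_of_mul_eq_mul_right hD ?_
  rw [h1]
  have hle : Nat.log p (Nat.card D) ≤ Nat.log p (Nat.card A) :=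
    Nat.log_mono_right (Nat.card_le_card_of_injective _ (Subgroup.inclusion_injective h))
  conv_rhs => rw [(hG.to_subgroup D).card_eq_pow_log, Nat.log_pow hp.out.one_lt]
  rw [← pow_add, Nat.sub_add_cancel hle]
  exact (hG.to_subgroup A).card_eq_pow_log

variable {p : ℕ} [hp : Fact p.Prime] {G : Type*} [Group G] [Finite G] {M : Subgroup G} [M.Normal]

theorem IsPGroup.log_powSubgroup_even_le (hG : IsPGroup p G)
    (hc : ∀ x ∈ M, ∀ y ∈ M, x * y = y * x) (b : ℕ) :
    (Nat.log p (Nat.card (powSubgroup M hc (p ^ (2 * (b + 1))))) : ℝ) ≤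
      Nat.log p (Nat.card (powSubgroup M hc (p ^ (2 * (b + 1 + 1))))) +
        2 * Nat.card (ConjClasses G) / 2 ^ (b + 1) := by
  have hDA : powSubgroup M hc (p ^ (2 * (b + 1 + 1))) ≤ powSubgroup M hc (p ^ (2 * (b + 1))) :=
    powSubgroup_le_powSubgroup (pow_dvd_pow p (by omega))
  have h2 := (hG.to_quotient (powSubgroup M hc (p ^ (2 * (b + 1 + 1))))).pow_mul_le
    (M := M.map (QuotientGroup.mk' _)) (Subgroup.map_commutes hc _) (s := b + 2) (b := b)
    (ρ := Nat.log p (Nat.card (powSubgroup M hc (p ^ (2 * (b + 1))))) -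
      Nat.log p (Nat.card (powSubgroup M hc (p ^ (2 * (b + 1 + 1)))))) (by
      rintro _ ⟨x, hx, rfl⟩
      rw [← map_pow]
      exact (QuotientGroup.eq_one_iff _).2 ⟨x, hx, rfl⟩) (by
      rw [powSubgroup_map, ← hG.card_map_mk' hDA, show b + 2 + b = 2 * (b + 1) by ring])
  have h3 := h2.trans (Nat.mul_le_mul_left 2 (card_conjClasses_quotient_le _))
  set m := Nat.log p (Nat.card (powSubgroup M hc (p ^ (2 * (b + 1)))))
  set n := Nat.log p (Nat.card (powSubgroup M hc (p ^ (2 * (b + 1 + 1)))))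
  have h4 : 2 ^ (b + 1) * (m - n) ≤ 2 * Nat.card (ConjClasses G) :=
    (Nat.mul_le_mul_right _ (Nat.pow_le_pow_left hp.out.two_le _)).trans h3
  have h5 : (2 : ℝ) ^ (b + 1) * ((m : ℝ) - n) ≤ 2 * Nat.card (ConjClasses G) := by
    have h6 : (2 : ℝ) ^ (b + 1) * ((m - n : ℕ) : ℝ) ≤ 2 * Nat.card (ConjClasses G) := by
      exact_mod_cast h4
    refine le_trans (mul_le_mul_of_nonneg_left ?_ (by positivity)) h6
    rw [sub_le_iff_le_add]
    exact_mod_cast le_tsub_add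
  have h6 : (m : ℝ) - n ≤ 2 * Nat.card (ConjClasses G) / 2 ^ (b + 1) := by
    rw [le_div_iff₀ (by positivity), mul_comm]
    exact h5
  linarith

theorem IsPGroup.log_powSubgroup_le (hG : IsPGroup p G)
    (hc : ∀ x ∈ M, ∀ y ∈ M, x * y = y * x) (j : ℕ) {T : ℝ} (hT : 0 < T) :
    (Nat.log p (Nat.card (powSubgroup M hc (p ^ j))) : ℝ) ≤
      Nat.log p (Nat.card (powSubgroup M hc (p ^ (j + 1)))) +
        (Real.exp T + 4 * Nat.card (ConjClasses G) / T) := by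
  have hDA : powSubgroup M hc (p ^ (j + 1)) ≤ powSubgroup M hc (p ^ j) :=
    powSubgroup_le_powSubgroup (pow_dvd_pow p (by omega))
  have h2 := (hG.to_quotient (powSubgroup M hc (p ^ (j + 1)))).mul_harmonic_le
    (A := (powSubgroup M hc (p ^ j)).map (QuotientGroup.mk' _))
    (Subgroup.map_commutes (fun x hx y hy => hc x (powSubgroup_le _ hx) y (powSubgroup_le _ hy)) _)
    (by
      rintro _ ⟨_, ⟨x, hx, rfl⟩, rfl⟩
      rw [← map_pow]
      exact (QuotientGroup.eq_one_iff _).2 ⟨x, hx, by rw [pow_succ, pow_mul]⟩)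
    (hG.card_map_mk' hDA)
  set m := Nat.log p (Nat.card (powSubgroup M hc (p ^ j)))
  set n := Nat.log p (Nat.card (powSubgroup M hc (p ^ (j + 1))))
  have h3 : ((m - n : ℕ) : ℝ) * Real.log ((m - n : ℕ) + 1) ≤ 4 * Nat.card (ConjClasses G) := by
    refine le_trans ?_ (h2.trans ?_)
    · refine mul_le_mul_of_nonneg_left ?_ (by positivity)
      exact_mod_cast log_add_one_le_harmonic (m - n)
    · gcongr
      exact card_conjClasses_quotient_le _
  have h4 : (m : ℝ) - n ≤ (m - n : ℕ) := by
    rw [sub_le_iff_le_add]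
    exact_mod_cast le_tsub_add
  set ρ : ℝ := ((m - n : ℕ) : ℝ)
  have hρ : 0 ≤ ρ := Nat.cast_nonneg _
  have hk : (0 : ℝ) ≤ 4 * Nat.card (ConjClasses G) / T := by positivity
  suffices ρ ≤ Real.exp T + 4 * Nat.card (ConjClasses G) / T by linarith
  rcases le_or_gt T (Real.log (ρ + 1)) with h | h
  · have : ρ ≤ 4 * Nat.card (ConjClasses G) / T := by
      rw [le_div_iff₀ hT]
      exact (mul_le_mul_of_nonneg_left h hρ).trans h3
    have := Real.exp_pos T
    linarith
  · rw [Real.log_lt_iff_lt_exp (by positivity)] at h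
    linarith

end AbelianNormal

/-- The composition length of an abelian normal subgroup of a finite `p`-group is at most a
constant plus an arbitrarily small multiple of the number of conjugacy classes. -/
theorem exists_forall_log_card_abelian_le {ε : ℝ} (hε : 0 < ε) :
    ∃ K : ℝ, ∀ (p : ℕ) [Fact p.Prime] (G : Type) [Group G] [Finite G], IsPGroup p G →
      ∀ (M : Subgroup G) [M.Normal], (∀ x ∈ M, ∀ y ∈ M, x * y = y * x) →
        (Nat.log p (Nat.card M) : ℝ) ≤ K + ε * Nat.card (ConjClasses G) := by
  obtain ⟨J, hJ⟩ : ∃ J : ℕ, 4 * (1 / 2 : ℝ) ^ (J + 1) ≤ ε / 2 := by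
    obtain ⟨J, hJ⟩ := exists_pow_lt_of_lt_one (show (0 : ℝ) < ε / 8 by positivity)
      (show (1 / 2 : ℝ) < 1 by norm_num)
    refine ⟨J, ?_⟩
    rw [pow_succ]
    linarith
  set T : ℝ := 16 * (J + 1) / ε with hT
  have hTpos : 0 < T := by positivity
  refine ⟨2 * (J + 1) * Real.exp T, ?_⟩
  intro p hp G _ _ hG M _ hc
  set k : ℝ := (Nat.card (ConjClasses G) : ℝ) with hk
  have hk0 : 0 ≤ k := Nat.cast_nonneg _
  set l : ℕ → ℝ := fun j => Nat.log p (Nat.card (powSubgroup M hc (p ^ j))) with hl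
  have hA : ∀ j, l j ≤ l (j + 1) + (Real.exp T + 4 * k / T) :=
    fun j => hG.log_powSubgroup_le hc j hTpos
  have hB : ∀ b : ℕ, l (2 * (b + 1)) ≤ l (2 * (b + 1 + 1)) + 2 * k / 2 ^ (b + 1) :=
    fun b => hG.log_powSubgroup_even_le hc b
  have h1 : ∀ b : ℕ, l 0 ≤ l (2 * b) + b * (2 * (Real.exp T + 4 * k / T)) := by
    intro b
    induction b with
    | zero => simp
    | succ b ih =>
      have e1 := hA (2 * b)
      have e2 := hA (2 * b + 1)
      rw [show 2 * b + 1 + 1 = 2 * (b + 1) by ring] at e2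
      push_cast
      linarith
  have h2 : ∀ i : ℕ, l (2 * (J + 1)) ≤
      l (2 * (J + i + 1)) + (4 * (1 / 2 : ℝ) ^ (J + 1) - 4 * (1 / 2 : ℝ) ^ (J + i + 1)) * k := by
    intro i
    induction i with
    | zero => simp
    | succ i ih =>
      have e1 := hB (J + i)
      have e2 : 2 * k / 2 ^ (J + i + 1) = 2 * k * (1 / 2 : ℝ) ^ (J + i + 1) := by
        rw [one_div, inv_pow, div_eq_mul_inv]
      rw [e2] at e1
      have e3 : (1 / 2 : ℝ) ^ (J + (i + 1) + 1) = (1 / 2) * (1 / 2 : ℝ) ^ (J + i + 1) := by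
        rw [← add_assoc, pow_succ' _ (J + i + 1)]
      rw [e3, ← add_assoc]
      linarith
  obtain ⟨n, hn⟩ := IsPGroup.iff_card.1 hG
  have h3 : l (2 * (J + n + 1)) = 0 := by
    simp only [hl]
    have : powSubgroup M hc (p ^ (2 * (J + n + 1))) = ⊥ := by
      rw [eq_bot_iff]
      rintro _ ⟨x, hx, rfl⟩
      rw [Subgroup.mem_bot]
      have e1 : x ^ p ^ n = 1 := by rw [← hn]; exact pow_card_eq_one'
      rw [show 2 * (J + n + 1) = n + (2 * J + n + 2) by ring, pow_add, pow_mul, e1, one_pow]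
    rw [this]
    simp
  have h4 : l 0 = Nat.log p (Nat.card M) := by
    simp only [hl]
    have : powSubgroup M hc (p ^ 0) = M := by
      ext x
      simp [mem_powSubgroup]
    rw [this]
  have e1 := h1 (J + 1)
  have e2 := h2 n
  rw [h3] at e2
  have e3 : (1 / 2 : ℝ) ^ (J + n + 1) * k ≥ 0 := by positivity
  have e4 : (4 * (1 / 2 : ℝ) ^ (J + 1)) * k ≤ ε / 2 * k := by gcongr
  have e5 : ((J : ℝ) + 1) * (2 * (4 * k / T)) = ε / 2 * k := by
    rw [hT]
    field_simp
    ring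
  rw [← h4]
  push_cast at e1
  linarith

section LowerCentral

theorem Subgroup.commutator_commutator_le_of_rotate {G : Type*} [Group G] {A B C N : Subgroup G}
    [N.Normal] (h1 : ⁅⁅B, C⁆, A⁆ ≤ N) (h2 : ⁅⁅C, A⁆, B⁆ ≤ N) : ⁅⁅A, B⁆, C⁆ ≤ N := by
  have key : ∀ H : Subgroup G, H ≤ N ↔ H.map (QuotientGroup.mk' N) = ⊥ := by
    intro H
    rw [Subgroup.map_eq_bot_iff, QuotientGroup.ker_mk']
  rw [key, Subgroup.map_commutator, Subgroup.map_commutator] at h1 h2 ⊢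
  exact Subgroup.commutator_commutator_eq_bot_of_rotate h1 h2

theorem Subgroup.commutator_lowerCentralSeries_le {G : Type*} [Group G] (j i : ℕ) :
    ⁅(⊤ : Subgroup G).lowerCentralSeries j, (⊤ : Subgroup G).lowerCentralSeries i⁆
      ≤ (⊤ : Subgroup G).lowerCentralSeries (i + j + 1) := by
  induction j generalizing i with
  | zero =>
    rw [Subgroup.commutator_comm, Subgroup.lowerCentralSeries_zero, add_zero,
      Subgroup.lowerCentralSeries_succ]
  | succ j ih =>
    rw [Subgroup.lowerCentralSeries_succ]
    refine Subgroup.commutator_commutator_le_of_rotate ?_ ?_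
    · rw [Subgroup.commutator_comm ⊤, ← Subgroup.lowerCentralSeries_succ, Subgroup.commutator_comm]
      refine (ih (i + 1)).trans (le_of_eq ?_)
      congr 1
      ring
    · rw [← add_assoc, Subgroup.lowerCentralSeries_succ]
      refine Subgroup.commutator_mono ?_ le_rfl
      rw [Subgroup.commutator_comm]
      exact ih i

variable {G : Type*} [Group G] [Finite G]

local notation "γ" => Subgroup.lowerCentralSeries (⊤ : Subgroup G)

theorem log_card_eq_sum_lowerCentralSeries (p n : ℕ) :
    Nat.log p (Nat.card G) = ∑ j ∈ Finset.range n,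
      (Nat.log p (Nat.card (γ j)) - Nat.log p (Nat.card (γ (j + 1))))
      + Nat.log p (Nat.card (γ n)) := by
  induction n with
  | zero => simp
  | succ n ih =>
    have hle : γ (n + 1) ≤ γ n := Subgroup.lowerCentralSeries_antitone _ (Nat.le_succ n)
    have : Nat.log p (Nat.card (γ (n + 1))) ≤ Nat.log p (Nat.card (γ n)) :=
      Nat.log_mono_right (Nat.card_le_card_of_injective _ (Subgroup.inclusion_injective hle))
    rw [ih, Finset.sum_range_succ]
    omega

variable {p : ℕ} [hp : Fact p.Prime]

/-- Each factor of the lower central series of a `p`-group contributes its nontrivial elements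
to the number of conjugacy classes. -/
theorem IsPGroup.sum_lowerCentralSeries_le (hG : IsPGroup p G) (n : ℕ) :
    1 + ∑ j ∈ Finset.range n,
      (p ^ (Nat.log p (Nat.card (γ j)) - Nat.log p (Nat.card (γ (j + 1)))) - 1)
      ≤ Nat.card (ConjClasses G) := by
  have := Fintype.ofFinite G
  have hstep : ∀ j, (p ^ (Nat.log p (Nat.card (γ j)) - Nat.log p (Nat.card (γ (j + 1)))) - 1)
      * Nat.card G ≤ commCount ((γ j : Set G) \ γ (j + 1)) := by
    intro j
    have hle : γ (j + 1) ≤ γ j := Subgroup.lowerCentralSeries_antitone _ (Nat.le_succ j)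
    have h1 := ncard_image_mul_card_le_commCount (S := (γ j : Set G) \ γ (j + 1))
      (fun g x hx => Subgroup.conj_mem_sdiff g x hx) (QuotientGroup.mk' (γ (j + 1))) (by
        intro g x hx
        rw [← mul_inv_eq_one, ← map_inv, ← map_mul]
        refine (QuotientGroup.eq_one_iff _).2 ?_
        rw [Subgroup.lowerCentralSeries_succ, Subgroup.commutator_comm]
        exact Subgroup.commutator_mem_commutator (Subgroup.mem_top g) hx.1)
    refine le_trans (Nat.mul_le_mul_right _ ?_) h1
    have h2 : ((γ j).map (QuotientGroup.mk' (γ (j + 1))) : Set (G ⧸ γ (j + 1))) ⊆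
        insert 1 (QuotientGroup.mk' (γ (j + 1)) '' ((γ j : Set G) \ γ (j + 1))) := by
      rintro _ ⟨x, hx, rfl⟩
      by_cases hx' : x ∈ γ (j + 1)
      · exact Or.inl ((QuotientGroup.eq_one_iff _).2 hx')
      · exact Or.inr ⟨x, ⟨hx, hx'⟩, rfl⟩
    have h3 := (Set.ncard_le_ncard h2).trans (Set.ncard_insert_le _ _)
    rw [← Nat.card_coe_set_eq, SetLike.coe_sort_coe, hG.card_map_mk' hle] at h3
    omega
  have hsum : ∀ n, (∑ j ∈ Finset.range n,
      (p ^ (Nat.log p (Nat.card (γ j)) - Nat.log p (Nat.card (γ (j + 1)))) - 1)) * Nat.card G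
      + commCount (γ n : Set G) ≤ commCount (Set.univ : Set G) := by
    intro n
    induction n with
    | zero => simp
    | succ n ih =>
      have hle : γ (n + 1) ≤ γ n := Subgroup.lowerCentralSeries_antitone _ (Nat.le_succ n)
      have h1 : commCount (γ n : Set G)
          = commCount ((γ n : Set G) \ γ (n + 1)) + commCount (γ (n + 1) : Set G) := by
        rw [← commCount_union Set.disjoint_sdiff_left, Set.sdiff_union_of_subset hle]
      have h2 := hstep n
      rw [Finset.sum_range_succ, add_mul]
      omega
  have h1 := hsum n
  have h2 : Nat.card G ≤ commCount (γ n : Set G) :=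
    card_le_commCount (fun g x hx => Subgroup.Normal.conj_mem inferInstance x hx g)
      ⟨1, one_mem _⟩
  rw [commCount_univ] at h1
  have hpos : 0 < Nat.card G := Nat.card_pos
  refine Nat.le_of_mul_le_mul_right ?_ hpos
  rw [add_mul, one_mul]
  omega

theorem IsPGroup.one_add_mul_le_card_conjClasses (hG : IsPGroup p G) :
    1 + (p - 1) * Nat.log p (Nat.card G) ≤ Nat.card (ConjClasses G) := by
  have hnil := hG.isNilpotent
  obtain ⟨n, hn⟩ := Subgroup.nilpotent_iff_lowerCentralSeries.1 hnil
  have h1 := log_card_eq_sum_lowerCentralSeries (G := G) p n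
  rw [hn, Subgroup.card_bot, Nat.log_one_right, add_zero] at h1
  refine le_trans ?_ (hG.sum_lowerCentralSeries_le n)
  rw [h1, Finset.mul_sum]
  refine Nat.add_le_add_left (Finset.sum_le_sum fun j _ => ?_) 1
  set d := Nat.log p (Nat.card (γ j)) - Nat.log p (Nat.card (γ (j + 1)))
  obtain ⟨q, rfl⟩ : ∃ q, p = q + 1 := ⟨p - 1, by have := hp.out.pos; omega⟩
  have h2 : 1 + d * q ≤ (1 + q) ^ d := by
    have := one_add_mul_le_pow_of_sq_nonneg (R := ℕ) (a := q) (Nat.zero_le _) (Nat.zero_le _)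
      (Nat.zero_le _) d
    simpa using this
  rw [add_comm q 1, Nat.add_sub_cancel_left, mul_comm]
  omega

theorem IsPGroup.lowerCentralSeries_card_conjClasses (hG : IsPGroup p G) :
    γ (Nat.card (ConjClasses G)) = ⊥ := by
  have hnil := hG.isNilpotent
  by_contra hne
  set k := Nat.card (ConjClasses G) with hk
  have h1 := hG.sum_lowerCentralSeries_le k
  have h2 : ∀ j ∈ Finset.range k, 1 ≤
      p ^ (Nat.log p (Nat.card (γ j)) - Nat.log p (Nat.card (γ (j + 1)))) - 1 := by
    intro j hj
    have hle : γ (j + 1) ≤ γ j := Subgroup.lowerCentralSeries_antitone _ (Nat.le_succ j)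
    have hlt : γ (j + 1) < γ j := by
      refine lt_of_le_of_ne hle fun heq => hne ?_
      have h3 : ∀ i, γ (j + i) = γ j := by
        intro i
        induction i with
        | zero => rfl
        | succ i ih =>
          rw [← add_assoc, Subgroup.lowerCentralSeries_succ, ih,
            ← Subgroup.lowerCentralSeries_succ, heq]
      obtain ⟨n, hn⟩ := Subgroup.nilpotent_iff_lowerCentralSeries.1 hnil
      have h4 : γ j = ⊥ := by
        rw [← h3 n, eq_bot_iff, ← hn]
        exact Subgroup.lowerCentralSeries_antitone _ (Nat.le_add_left n j)
      rw [eq_bot_iff, ← h4]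
      exact Subgroup.lowerCentralSeries_antitone _ (Finset.mem_range.1 hj).le
    have h5 : Nat.card (γ (j + 1)) < Nat.card (γ j) := by
      by_contra hge
      exact hlt.ne (Subgroup.eq_of_le_of_card_ge hle (not_lt.1 hge))
    rw [(hG.to_subgroup (γ j)).card_eq_pow_log, (hG.to_subgroup (γ (j + 1))).card_eq_pow_log,
      Nat.pow_lt_pow_iff_right hp.out.one_lt] at h5
    have h6 := Nat.one_lt_pow (n := Nat.log p (Nat.card (γ j)) - Nat.log p (Nat.card (γ (j + 1))))
      (by omega) hp.out.one_lt
    omega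
  have h3 := Finset.sum_le_sum h2
  rw [Finset.sum_const, Finset.card_range, smul_eq_mul, mul_one] at h3
  omega

theorem IsPGroup.log_card_le_add (hG : IsPGroup p G) (T i : ℕ) :
    (Nat.log p (Nat.card G) : ℝ) ≤ Nat.log p (Nat.card (γ i)) + T * i +
      (1 / 2) ^ T * (Nat.card (ConjClasses G) + i) := by
  have h1 := log_card_eq_sum_lowerCentralSeries (G := G) p i
  have h2 := hG.sum_lowerCentralSeries_le i
  set d : ℕ → ℕ := fun j => Nat.log p (Nat.card (γ j)) - Nat.log p (Nat.card (γ (j + 1))) with hd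
  have h3 : ∀ j ∈ Finset.range i, (d j : ℝ) ≤ T + (1 / 2) ^ T * ((p ^ d j - 1 : ℕ) + 1) := by
    intro j _
    have h4 : (2 : ℝ) ^ d j ≤ (p ^ d j - 1 : ℕ) + 1 := by
      have : 2 ^ d j ≤ p ^ d j - 1 + 1 :=
        (Nat.pow_le_pow_left hp.out.two_le _).trans (by omega)
      exact_mod_cast this
    have h5 : (d j : ℝ) ≤ T + (1 / 2) ^ T * 2 ^ d j := by
      rcases le_or_gt (d j) T with h | h
      · have : (d j : ℝ) ≤ T := by exact_mod_cast h
        have : (0 : ℝ) ≤ (1 / 2) ^ T * 2 ^ d j := by positivity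
        linarith
      · obtain ⟨e, he⟩ := Nat.exists_eq_add_of_lt h
        rw [he, add_assoc, pow_add, ← mul_assoc, ← mul_pow]
        norm_num
        have := (Nat.lt_two_pow_self (n := e + 1)).le
        exact_mod_cast this
    have : (1 / 2 : ℝ) ^ T * 2 ^ d j ≤ (1 / 2) ^ T * ((p ^ d j - 1 : ℕ) + 1) := by gcongr
    linarith
  have h4 := Finset.sum_le_sum h3
  rw [Finset.sum_add_distrib, ← Finset.mul_sum, Finset.sum_add_distrib, Finset.sum_const,
    Finset.sum_const, Finset.card_range, nsmul_eq_mul, nsmul_eq_mul, mul_one, ← Nat.cast_sum,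
    ← Nat.cast_sum] at h4
  have h5 : ((∑ j ∈ Finset.range i, (p ^ d j - 1) : ℕ) : ℝ) ≤ Nat.card (ConjClasses G) := by
    exact_mod_cast (Nat.le_add_left _ 1).trans h2
  have h6 : (Nat.log p (Nat.card G) : ℝ) = ((∑ j ∈ Finset.range i, d j : ℕ) : ℝ) +
      Nat.log p (Nat.card (γ i)) := by exact_mod_cast h1
  have h7 : (1 / 2 : ℝ) ^ T * (((∑ j ∈ Finset.range i, (p ^ d j - 1) : ℕ) : ℝ) + i) ≤
      (1 / 2) ^ T * (Nat.card (ConjClasses G) + i) := by gcongr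
  rw [h6]
  linarith [mul_comm (T : ℝ) i]

end LowerCentral

/-- The composition length of a finite `p`-group is at most a constant plus an arbitrarily small
multiple of the number of conjugacy classes. -/
theorem exists_forall_log_card_le {δ : ℝ} (hδ : 0 < δ) :
    ∃ K : ℝ, ∀ (p : ℕ) [Fact p.Prime] (G : Type) [Group G] [Finite G], IsPGroup p G →
      (Nat.log p (Nat.card G) : ℝ) ≤ K + δ * Nat.card (ConjClasses G) := by
  obtain ⟨T, hT⟩ := exists_pow_lt_of_lt_one (show (0 : ℝ) < δ / 3 by positivity)
    (show (1 / 2 : ℝ) < 1 by norm_num)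
  set η : ℝ := δ / (3 * (T + 1)) with hη
  have hη0 : 0 < η := by positivity
  obtain ⟨L, hL⟩ : ∃ L : ℕ, 1 ≤ 2 ^ L * η := by
    obtain ⟨L, hL⟩ := pow_unbounded_of_one_lt (1 / η) (show (1 : ℝ) < 2 by norm_num)
    exact ⟨L, by rw [div_lt_iff₀ hη0] at hL; exact hL.le⟩
  set ε : ℝ := δ / (3 * (L + 1)) with hε
  have hε0 : 0 < ε := by positivity
  obtain ⟨K, hK⟩ := exists_forall_log_card_abelian_le hε0
  refine ⟨L * K + (T + 1), ?_⟩
  intro p hp G _ _ hG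
  set k : ℝ := (Nat.card (ConjClasses G) : ℝ) with hk
  have hk0 : 0 ≤ k := Nat.cast_nonneg _
  set γ := Subgroup.lowerCentralSeries (⊤ : Subgroup G) with hγ
  set l : ℕ → ℝ := fun i => Nat.log p (Nat.card (γ i)) with hl
  have hdouble : ∀ i, l i ≤ l (2 * i + 1) + (K + ε * k) := by
    intro i
    have hle : γ (2 * i + 1) ≤ γ i := Subgroup.lowerCentralSeries_antitone _ (by omega)
    have h1 := hK p (G ⧸ γ (2 * i + 1)) (hG.to_quotient _)
      ((γ i).map (QuotientGroup.mk' _)) (by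
        rintro _ ⟨x, hx, rfl⟩ _ ⟨y, hy, rfl⟩
        have h2 := Subgroup.commutator_lowerCentralSeries_le i i
          (Subgroup.commutator_mem_commutator hx hy)
        rw [← two_mul, ← QuotientGroup.ker_mk' (Subgroup.lowerCentralSeries ⊤ (2 * i + 1)),
          MonoidHom.mem_ker] at h2
        rw [map_commutatorElement, commutatorElement_eq_one_iff_mul_comm] at h2
        exact h2)
    rw [hG.card_map_mk' hle, Nat.log_pow hp.out.one_lt] at h1
    have h2 : (Nat.card (ConjClasses (G ⧸ γ (2 * i + 1))) : ℝ) ≤ k := by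
      rw [hk]
      exact_mod_cast card_conjClasses_quotient_le _
    have h3 : l i - l (2 * i + 1) ≤
        ((Nat.log p (Nat.card (γ i)) - Nat.log p (Nat.card (γ (2 * i + 1))) : ℕ) : ℝ) := by
      simp only [hl]
      rw [sub_le_iff_le_add]
      exact_mod_cast le_tsub_add
    have h4 : ε * (Nat.card (ConjClasses (G ⧸ γ (2 * i + 1))) : ℝ) ≤ ε * k := by gcongr
    linarith
  have hiter : ∀ i t : ℕ, ∃ j, 2 ^ t * i ≤ j ∧ l i ≤ l j + t * (K + ε * k) := by
    intro i t
    induction t with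
    | zero => exact ⟨i, by simp, by simp⟩
    | succ t ih =>
      obtain ⟨j, hj, hj'⟩ := ih
      refine ⟨2 * j + 1, by rw [pow_succ]; nlinarith, ?_⟩
      have := hdouble j
      push_cast
      linarith
  set i₀ : ℕ := ⌈η * k⌉₊ with hi₀
  have hi1 : η * k ≤ i₀ := Nat.le_ceil _
  have hi2 : (i₀ : ℝ) ≤ η * k + 1 := (Nat.ceil_lt_add_one (by positivity)).le
  obtain ⟨j, hj, hj'⟩ := hiter i₀ L
  have hjk : Nat.card (ConjClasses G) ≤ j := by
    have h1 : k ≤ 2 ^ L * (i₀ : ℝ) := by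
      calc k = 1 * k := (one_mul k).symm
        _ ≤ (2 ^ L * η) * k := by gcongr
        _ = 2 ^ L * (η * k) := by ring
        _ ≤ _ := by gcongr
    rw [hk] at h1
    have h2 : Nat.card (ConjClasses G) ≤ 2 ^ L * i₀ := by exact_mod_cast h1
    exact h2.trans hj
  have hlj : l j = 0 := by
    have : γ j = ⊥ := by
      rw [eq_bot_iff, ← hG.lowerCentralSeries_card_conjClasses]
      exact Subgroup.lowerCentralSeries_antitone _ hjk
    simp [hl, this]
  rw [hlj, zero_add] at hj'
  have h1 := hG.log_card_le_add T i₀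
  have h2 : (1 / 2 : ℝ) ^ T * (k + i₀) ≤ δ / 3 * k + i₀ := by
    have h3 : (1 / 2 : ℝ) ^ T ≤ 1 := pow_le_one₀ (by norm_num) (by norm_num)
    have h4 : (1 / 2 : ℝ) ^ T * k ≤ δ / 3 * k := by gcongr
    have h5 : (1 / 2 : ℝ) ^ T * i₀ ≤ 1 * i₀ := by gcongr
    linarith
  have h3 : ((T : ℝ) + 1) * i₀ ≤ (T + 1) * (η * k + 1) := by gcongr
  have h4 : ((T : ℝ) + 1) * (η * k) = δ / 3 * k := by
    rw [hη]
    field_simp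
  have h5 : (L : ℝ) * (ε * k) ≤ δ / 3 * k := by
    have : (L + 1 : ℝ) * (ε * k) = δ / 3 * k := by
      rw [hε]
      field_simp
    have : 0 ≤ ε * k := by positivity
    linarith
  change (Nat.log p (Nat.card G) : ℝ) ≤ l i₀ + T * i₀ + (1 / 2 : ℝ) ^ T * (k + i₀) at h1
  linarith

/-- The number of conjugacy classes of a finite `p`-group grows faster than its composition
length. -/
theorem exists_forall_mul_lt_card_conjClasses {C : ℝ} (hC : 0 < C) :
    ∃ N : ℕ, ∀ (p : ℕ) [Fact p.Prime] (G : Type) [Group G] [Finite G], IsPGroup p G →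
      N ≤ Nat.card G →
      C * (Nat.log p (Nat.card G) + 1) < Nat.card (ConjClasses G) := by
  obtain ⟨K, hK⟩ := exists_forall_log_card_le (show (0 : ℝ) < 1 / (2 * C) by positivity)
  set m₀ : ℕ := ⌈2 * K + 1⌉₊ with hm₀
  set q : ℕ := ⌈2 * C⌉₊ + 1 with hq
  refine ⟨q ^ m₀ + 1, ?_⟩
  intro p hp G _ _ hG hN
  have h1 := hK p G hG
  have h2 := hG.one_add_mul_le_card_conjClasses
  have hcard := hG.card_eq_pow_log
  set m := Nat.log p (Nat.card G) with hm
  set k := Nat.card (ConjClasses G) with hk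
  have hp2 := hp.out.two_le
  have hm1 : 1 ≤ m := by
    by_contra h
    have : m = 0 := by omega
    rw [this, pow_zero] at hcard
    have : 0 < q ^ m₀ := by positivity
    omega
  rcases Nat.lt_or_ge q p with h | h
  · have h3 : 2 * C < p := by
      have : (⌈2 * C⌉₊ : ℝ) < p := by exact_mod_cast (by omega : ⌈2 * C⌉₊ < p)
      exact (Nat.le_ceil _).trans_lt this
    have h4 : (1 : ℝ) + (p - 1) * m ≤ k := by
      have : ((1 + (p - 1) * m : ℕ) : ℝ) ≤ k := by exact_mod_cast h2
      rw [Nat.cast_add, Nat.cast_mul, Nat.cast_sub (by omega)] at this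
      simpa using this
    have h5 : (1 : ℝ) ≤ m := by exact_mod_cast hm1
    have h6 : (2 : ℝ) ≤ p := by exact_mod_cast hp2
    nlinarith [mul_nonneg (sub_nonneg.2 h5) (sub_nonneg.2 h6)]
  · have h3 : m₀ < m := by
      by_contra hle
      have : p ^ m ≤ q ^ m₀ :=
        (Nat.pow_le_pow_left h m).trans (Nat.pow_le_pow_right (by omega) (not_lt.1 hle))
      omega
    have h4 : 2 * K + 1 < m := (Nat.le_ceil _).trans_lt (by exact_mod_cast h3)
    have h5 : (m : ℝ) * (2 * C) ≤ K * (2 * C) + k := by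
      have := mul_le_mul_of_nonneg_right h1 (show (0 : ℝ) ≤ 2 * C by positivity)
      have e : (K + 1 / (2 * C) * k) * (2 * C) = K * (2 * C) + k := by field_simp
      rwa [e] at this
    nlinarith

section Degrees

/-- A linear endomorphism of finite order of a complex vector space has integral trace. -/
theorem LinearMap.isIntegral_trace_of_pow_eq_one {V : Type*} [AddCommGroup V] [Module ℂ V]
    [FiniteDimensional ℂ V] {f : Module.End ℂ V} {n : ℕ} (hn : 0 < n) (hf : f ^ n = 1) :
    IsIntegral ℤ (LinearMap.trace ℂ V f) := by
  rw [Module.End.trace_eq_sum_roots_charpoly_of_splits (IsAlgClosed.splits _)]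
  refine IsIntegral.multiset_sum fun μ hμ => ?_
  have h1 : f.HasEigenvalue μ :=
    (Module.End.hasEigenvalue_iff_isRoot_charpoly f μ).2 (Polynomial.isRoot_of_mem_roots hμ)
  obtain ⟨v, hv⟩ := h1.exists_hasEigenvector
  have h2 : μ ^ n • v = (1 : ℂ) • v := by
    rw [← hv.pow_apply n, hf, one_smul, Module.End.one_apply]
  refine IsIntegral.of_pow hn ?_
  rw [smul_left_injective ℂ hv.2 h2]
  exact isIntegral_one

/-- The degree of a complex irreducible representation divides the order of the group. -/
theorem FDRep.finrank_dvd_card {G : Type} [Group G] [Finite G] (V : FDRep ℂ G) [Simple V] :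
    Module.finrank ℂ V ∣ Nat.card G := by
  have := Fintype.ofFinite G
  have h_int : ∀ g : G, IsIntegral ℤ (V.character g) := fun g =>
    LinearMap.isIntegral_trace_of_pow_eq_one (Nat.card_pos (α := G))
      (by rw [← map_pow, pow_card_eq_one', map_one])
  set T : Module.End ℂ V := ∑ g : G, V.character g⁻¹ • V.ρ g with hT
  have hTh : ∀ h : G, T * V.ρ h = ∑ g : G, V.character g⁻¹ • V.ρ (g * h) := fun h => by
    rw [hT, Finset.sum_mul]
    exact Finset.sum_congr rfl fun g _ => by rw [smul_mul_assoc, map_mul]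
  have hcomm : ∀ h : G, T * V.ρ h = V.ρ h * T := fun h => by
    rw [hTh, hT, Finset.mul_sum, ← (MulAut.conj h).toEquiv.sum_comp]
    refine Finset.sum_congr rfl fun g _ => ?_
    have h1 : (h * g * h⁻¹)⁻¹ = h * g⁻¹ * h⁻¹ := by group
    simp only [MulEquiv.toEquiv_eq_coe, EquivLike.coe_coe, MulAut.conj_apply]
    rw [h1, FDRep.char_conj, mul_smul_comm, ← map_mul, inv_mul_cancel_right]
  let f : V ⟶ V := ⟨InducedCategory.homMk (ModuleCat.ofHom T), fun g => by
    ext v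
    exact LinearMap.congr_fun (hcomm g) v⟩
  obtain ⟨c, hc⟩ := endomorphism_simple_eq_smul_id ℂ f
  have hTc : T = c • (1 : Module.End ℂ V) := by
    have h1 := congrArg (fun e : V ⟶ V => e.hom.hom.hom) hc
    exact h1.symm
  have htr : c * Module.finrank ℂ V = Nat.card G := by
    have h1 := (FDRep.simple_iff_char_is_norm_one V).1 inferInstance
    have h2 := congrArg (LinearMap.trace ℂ V) hTc
    rw [map_smul, LinearMap.trace_one, smul_eq_mul, hT, map_sum] at h2
    rw [← h2, ← h1]
    refine Finset.sum_congr rfl fun g _ => ?_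
    rw [map_smul, smul_eq_mul, mul_comm]
    rfl
  have hd : (Module.finrank ℂ V : ℂ) ≠ 0 := by
    intro h
    rw [h, mul_zero] at htr
    exact Nat.card_pos.ne' (Nat.cast_eq_zero.1 htr.symm)
  have hcint : IsIntegral ℤ c := by
    obtain ⟨v, hv⟩ : ∃ v : V, v ≠ 0 := by
      have : Nontrivial V := Module.nontrivial_of_finrank_pos (R := ℂ)
        (Nat.pos_of_ne_zero (by exact_mod_cast hd))
      exact exists_ne 0
    refine isIntegral_trans (A := integralClosure ℤ ℂ) c ?_
    refine isIntegral_of_smul_mem_submodule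
      (Submodule.span (integralClosure ℤ ℂ) (Set.range fun g : G => V.ρ g v)) ?_ ?_ c ?_
    · intro h
      refine hv ?_
      rw [← Submodule.mem_bot (integralClosure ℤ ℂ), ← h]
      exact Submodule.subset_span ⟨1, by simp⟩
    · exact Submodule.fg_span (Set.finite_range _)
    · intro w hw
      induction hw using Submodule.span_induction with
      | mem w hw =>
        obtain ⟨h, rfl⟩ := hw
        have h1 : c • V.ρ h v = (T * V.ρ h) v := by rw [hTc]; simp
        simp only
        rw [h1, hTh, LinearMap.sum_apply]
        refine Submodule.sum_mem _ fun g _ => ?_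
        exact Submodule.smul_mem _ (⟨V.character g⁻¹, h_int _⟩ : integralClosure ℤ ℂ)
          (Submodule.subset_span ⟨g * h, rfl⟩)
      | zero => simp
      | add x y _ _ hx hy => rw [smul_add]; exact Submodule.add_mem _ hx hy
      | smul a x _ hx => rw [smul_comm]; exact Submodule.smul_mem _ a hx
  have hcq : c = algebraMap ℚ ℂ (Nat.card G / Module.finrank ℂ V) := by
    rw [eq_ratCast]
    push_cast
    rw [eq_div_iff hd, htr]
  rw [hcq, isIntegral_algebraMap_iff (algebraMap ℚ ℂ).injective,
    IsIntegrallyClosed.isIntegral_iff] at hcint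
  obtain ⟨z, hz⟩ := hcint
  rw [eq_intCast, eq_div_iff (by exact_mod_cast hd)] at hz
  refine Int.natCast_dvd_natCast.1 ⟨z, ?_⟩
  rw [mul_comm]
  exact_mod_cast hz.symm

theorem ncard_charDegrees_le {G : Type} [Group G] [Finite G] :
    (charDegrees G).ncard ≤ ∏ p ∈ (Nat.card G).primeFactors, ((Nat.card G).factorization p + 1) := by
  rw [← Nat.card_divisors Nat.card_pos.ne', ← Set.ncard_coe_finset]
  refine Set.ncard_le_ncard ?_ (Finset.finite_toSet _)
  rintro _ ⟨V, hV, rfl⟩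
  exact Nat.mem_divisors.2 ⟨FDRep.finrank_dvd_card V, Nat.card_pos.ne'⟩

end Degrees

section Nilpotent

theorem MulEquiv.card_conjClasses_eq {G H : Type*} [Group G] [Finite G] [Group H] [Finite H]
    (e : G ≃* H) : Nat.card (ConjClasses G) = Nat.card (ConjClasses H) :=
  le_antisymm
    (Nat.card_le_card_of_surjective _
      (ConjClasses.map_surjective (f := e.symm.toMonoidHom) e.symm.surjective))
    (Nat.card_le_card_of_surjective _ (ConjClasses.map_surjective (f := e.toMonoidHom) e.surjective))

theorem card_conjClasses_pi {ι : Type*} [Fintype ι] (H : ι → Type*) [∀ i, Group (H i)]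
    [∀ i, Finite (H i)] :
    Nat.card (ConjClasses (∀ i, H i)) = ∏ i, Nat.card (ConjClasses (H i)) := by
  have h1 := commProb_pi H
  simp only [commProb_def', Finset.prod_div_distrib, Nat.card_pi, Nat.cast_prod] at h1
  rw [div_left_inj' (Finset.prod_ne_zero_iff.2 fun i _ => by exact_mod_cast Nat.card_pos.ne')] at h1
  exact_mod_cast h1

theorem Group.IsNilpotent.exists_card_conjClasses_eq_prod {G : Type*} [Group G] [Finite G]
    (hG : Group.IsNilpotent G) :
    ∃ H : (Nat.card G).primeFactors → Subgroup G,
      (∀ q : (Nat.card G).primeFactors, IsPGroup q (H q)) ∧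
      (∀ q : (Nat.card G).primeFactors, Nat.card (H q) = q ^ (Nat.card G).factorization q) ∧
      Nat.card (ConjClasses G) = ∏ q, Nat.card (ConjClasses (H q)) := by
  have hnorm : ∀ (p : ℕ) (_ : Fact p.Prime) (P : Sylow p G), P.Normal :=
    ((Group.isNilpotent_of_finite_tfae (G := G)).out 0 3).1 hG
  have hp : ∀ q : (Nat.card G).primeFactors, Fact (q : ℕ).Prime := fun q =>
    ⟨Nat.prime_of_mem_primeFactors q.2⟩
  refine ⟨fun q => (default : Sylow q G), fun q => (default : Sylow q G).isPGroup', fun q =>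
    (default : Sylow q G).card_eq_multiplicity, ?_⟩
  have e := Sylow.directProductOfNormal (G := G) fun P => hnorm _ inferInstance P
  rw [← e.card_conjClasses_eq, card_conjClasses_pi]
  refine Finset.prod_congr rfl fun q _ => ?_
  have := (Sylow.unique_of_normal (default : Sylow q G) (hnorm _ inferInstance _)).instSubsingleton
  have := Fintype.ofFinite (Sylow q G)
  rw [card_conjClasses_pi]
  exact Fintype.prod_subsingleton (fun P : Sylow q G => Nat.card (ConjClasses P)) default

end Nilpotent

/-- `k(G)/|cd(G)| → ∞` as `|G| → ∞` over finite nilpotent groups `G`: for every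
real `C > 0` there exists `N` such that every finite nilpotent group `G` with
`|G| ≥ N` has more than `C · |cd(G)|` conjugacy classes, where `cd(G)` is the
set of irreducible character degrees of `G`. -/
theorem conjClasses_div_charDegrees_tendsto_atTop (C : ℝ) (hC : 0 < C) :
    ∃ N : ℕ, ∀ (G : Type) [Group G] [Finite G], Group.IsNilpotent G →
      N ≤ Nat.card G →
      C * ((charDegrees G).ncard : ℝ) < (Nat.card (ConjClasses G) : ℝ) := by
  obtain ⟨N, hN⟩ := exists_forall_mul_lt_card_conjClasses hC
  refine ⟨(N + 1) ^ N + 1, ?_⟩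
  intro G _ _ hG hcard
  obtain ⟨H, hH, hHcard, hprod⟩ := hG.exists_card_conjClasses_eq_prod
  have hp : ∀ q : (Nat.card G).primeFactors, Fact (q : ℕ).Prime := fun q =>
    ⟨Nat.prime_of_mem_primeFactors q.2⟩
  have hlog : ∀ q : (Nat.card G).primeFactors,
      Nat.log q (Nat.card (H q)) = (Nat.card G).factorization q := fun q => by
    rw [hHcard, Nat.log_pow (hp q).out.one_lt]
  have hdeg : (charDegrees G).ncard ≤
      ∏ q : (Nat.card G).primeFactors, ((Nat.card G).factorization q + 1) := by
    rw [Finset.prod_coe_sort _ fun p => (Nat.card G).factorization p + 1]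
    exact ncard_charDegrees_le
  have hle : ∀ q : (Nat.card G).primeFactors,
      (Nat.card G).factorization q + 1 ≤ Nat.card (ConjClasses (H q)) := by
    intro q
    refine le_trans ?_ (hH q).one_add_mul_le_card_conjClasses
    rw [hlog, add_comm]
    refine Nat.add_le_add_left (Nat.le_mul_of_pos_left _ ?_) 1
    have := (hp q).out.two_le
    omega
  obtain ⟨q₀, hq₀⟩ : ∃ q, N ≤ Nat.card (H q) := by
    by_contra! hlt
    have h1 : (Nat.card G).primeFactors ⊆ Finset.range N := by
      intro q hq
      have hq' := Nat.mem_primeFactors.1 hq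
      have h2 := hlt ⟨q, hq⟩
      rw [hHcard] at h2
      refine Finset.mem_range.2 (lt_of_le_of_lt (Nat.le_self_pow ?_ q) h2)
      exact (hq'.1.factorization_pos_of_dvd hq'.2.2 hq'.2.1).ne'
    have h2 : Nat.card G ≤ (N + 1) ^ (Nat.card G).primeFactors.card := by
      calc Nat.card G = ∏ q ∈ (Nat.card G).primeFactors, q ^ (Nat.card G).factorization q :=
            (Nat.prod_factorization_pow_eq_self Nat.card_pos.ne').symm
        _ ≤ ∏ q ∈ (Nat.card G).primeFactors, (N + 1) := by
            refine Finset.prod_le_prod' fun q hq => ?_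
            have h3 := hlt ⟨q, hq⟩
            rw [hHcard] at h3
            exact h3.le.trans (Nat.le_succ N)
        _ = _ := by rw [Finset.prod_const]
    have h3 := Finset.card_le_card h1
    rw [Finset.card_range] at h3
    have h4 : (N + 1) ^ (Nat.card G).primeFactors.card ≤ (N + 1) ^ N :=
      Nat.pow_le_pow_right (Nat.succ_pos N) h3
    omega
  have hlt := hN q₀ (H q₀) (hH q₀) hq₀
  rw [hlog] at hlt
  have hrest : ((∏ q ∈ Finset.univ.erase q₀, ((Nat.card G).factorization q + 1) : ℕ) : ℝ) ≤
      ((∏ q ∈ Finset.univ.erase q₀, Nat.card (ConjClasses (H q)) : ℕ) : ℝ) :=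
    Nat.cast_le.2 (Finset.prod_le_prod' fun q _ => hle q)
  have hpos : (0 : ℝ) <
      ((∏ q ∈ Finset.univ.erase q₀, ((Nat.card G).factorization q + 1) : ℕ) : ℝ) :=
    Nat.cast_pos.2 (Finset.prod_pos fun q _ => Nat.succ_pos _)
  rw [← Finset.mul_prod_erase _ _ (Finset.mem_univ q₀)] at hdeg hprod
  calc C * ((charDegrees G).ncard : ℝ)
      ≤ C * ((((Nat.card G).factorization q₀ + 1) *
          ∏ q ∈ Finset.univ.erase q₀, ((Nat.card G).factorization q + 1) : ℕ) : ℝ) := by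
        gcongr
    _ = (C * ((Nat.card G).factorization q₀ + 1)) *
          ((∏ q ∈ Finset.univ.erase q₀, ((Nat.card G).factorization q + 1) : ℕ) : ℝ) := by
        rw [Nat.cast_mul]
        push_cast
        ring
    _ < (Nat.card (ConjClasses (H q₀)) : ℝ) *
          ((∏ q ∈ Finset.univ.erase q₀, ((Nat.card G).factorization q + 1) : ℕ) : ℝ) := by
        gcongr
    _ ≤ (Nat.card (ConjClasses (H q₀)) : ℝ) *
          ((∏ q ∈ Finset.univ.erase q₀, Nat.card (ConjClasses (H q)) : ℕ) : ℝ) := by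
        gcongr
    _ = _ := by rw [hprod, Nat.cast_mul]
end

section
/- Let p be a prime and let P be a finite p-group of order p^m. Then P has at least m + 1 conjugacy classes, i.e., k(P) ≥ m + 1 = d(|P|). -/
/-- Passing to the quotient by a nontrivial normal subgroup strictly decreases the number of
conjugacy classes. -/
theorem card_conjClasses_quotient_lt {G : Type*} [Group G] [Finite G] (N : Subgroup G) [N.Normal]
    (hN : N ≠ ⊥) : Nat.card (ConjClasses (G ⧸ N)) < Nat.card (ConjClasses G) := by
  have hsurj : Function.Surjective (ConjClasses.map (QuotientGroup.mk' N)) :=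
    ConjClasses.map_surjective (QuotientGroup.mk'_surjective N)
  refine lt_of_le_of_ne (Nat.card_le_card_of_surjective _ hsurj) fun hcard => ?_
  have hinj := (hsurj.bijective_of_nat_card_le hcard.ge).injective
  obtain ⟨z, hz1⟩ := N.ne_bot_iff_exists_ne_one.mp hN
  refine hz1 (Subtype.ext ?_)
  have hconj : ConjClasses.mk (z : G) = ConjClasses.mk 1 := by
    refine hinj (congrArg ConjClasses.mk ?_)
    rw [map_one]
    exact (QuotientGroup.eq_one_iff (z : G)).mpr z.2
  exact isConj_one_left.mp (ConjClasses.mk_eq_mk_iff_isConj.mp hconj)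

/-- A nontrivial finite `p`-group has a normal subgroup of order `p`. -/
theorem IsPGroup.exists_normal_card_eq {p : ℕ} [Fact p.Prime] {G : Type*} [Group G] [Finite G]
    [Nontrivial G] (hG : IsPGroup p G) : ∃ N : Subgroup G, N.Normal ∧ Nat.card N = p := by
  have := hG.center_nontrivial
  have hdvd : p ∣ Nat.card (Subgroup.center G) :=
    (hG.to_subgroup _).card_eq_or_dvd.resolve_left Finite.one_lt_card.ne'
  obtain ⟨z, hz⟩ := exists_prime_orderOf_dvd_card' p hdvd
  refine ⟨Subgroup.zpowers (z : G), ⟨fun n hn g => ?_⟩, ?_⟩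
  · have hcomm := Subgroup.mem_center_iff.mp (Subgroup.zpowers_le.mpr z.2 hn) g
    rwa [hcomm, mul_inv_cancel_right]
  · rw [Nat.card_zpowers, Subgroup.orderOf_coe, hz]

/-- A finite `p`-group of order `p^m` has at least `m + 1 = d(p^m)` conjugacy
classes. -/
theorem pGroup_card_conjClasses_ge (p : ℕ) (hp : p.Prime) (m : ℕ)
    (P : Type*) [Group P] [Finite P] (hcard : Nat.card P = p ^ m) :
    m + 1 ≤ Nat.card (ConjClasses P) := by
  have : Fact p.Prime := ⟨hp⟩
  induction m generalizing P with
  | zero => exact Nat.card_pos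
  | succ m ih =>
    have : Nontrivial P := by
      rw [← Finite.one_lt_card_iff_nontrivial, hcard]
      exact Nat.one_lt_pow m.succ_ne_zero hp.one_lt
    obtain ⟨N, hN, hNcard⟩ := (IsPGroup.of_card hcard).exists_normal_card_eq
    have hquot : Nat.card (P ⧸ N) = p ^ m := by
      have h := N.card_eq_card_quotient_mul_card_subgroup
      rw [hcard, hNcard, pow_succ] at h
      exact (Nat.eq_of_mul_eq_mul_right hp.pos h).symm
    have hbot : N ≠ ⊥ := by
      rintro rfl
      exact hp.ne_one (hNcard.symm.trans Subgroup.card_bot)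
    exact (ih (P ⧸ N) hquot).trans_lt (card_conjClasses_quotient_lt N hbot)
end
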